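/- arXiv:1505.03550 — 4 statements merged into one kernel-verified Lean document; each statement's English description precedes it below -/
import Mathlib

section
/- Let n ≥ 2 and let K ⊂ ℝⁿ be a compact convex set with |K| = |D_n| and let ε ∈ (0,1). Then there exist a natural number N with N ≤ c·n¹³·(log n)³/ε^γ, where γ = 4 + 2/log n and c > 0 is a universal constant, and unit vectors u₁, …, u_N ∈ S^{n-1}, such that the body K' = S_{u_N}(⋯(S_{u₁}(K))⋯) obtained by successively applying the Steiner symmetrizations in directions u₁, …, u_N satisfies |K' Δ D_n|/|D_n| < ε. -/
open MeasureTheory Pointwise Metric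

/-- The Steiner symmetral of `K` in direction `u`: all points `y + t • u` with
`y ∈ u^⊥` such that the line `y + ℝu` meets `K` and
`|t| ≤ (1/2) · λ¹(K ∩ (y + ℝu))`. -/
noncomputable def steinerSymmetral {n : ℕ} (u : EuclideanSpace ℝ (Fin n))
    (K : Set (EuclideanSpace ℝ (Fin n))) : Set (EuclideanSpace ℝ (Fin n)) :=
  {z | ∃ (y : EuclideanSpace ℝ (Fin n)) (t : ℝ), y ∈ (ℝ ∙ u)ᗮ ∧
      z = y + t • u ∧ (∃ s : ℝ, y + s • u ∈ K) ∧
      |t| ≤ (volume {s : ℝ | y + s • u ∈ K}).toReal / 2}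

open scoped RealInnerProductSpace

section Structure

variable {n : ℕ} {u : EuclideanSpace ℝ (Fin n)} {K : Set (EuclideanSpace ℝ (Fin n))}

lemma isCompact_fibre (hu : ‖u‖ = 1) (hK : IsCompact K) (y : EuclideanSpace ℝ (Fin n)) :
    IsCompact {s : ℝ | y + s • u ∈ K} := by
  have h : Topology.IsClosedEmbedding fun s : ℝ => y + s • u := by
    refine Isometry.isClosedEmbedding (Isometry.of_dist_eq fun a b => ?_)
    simp [dist_eq_norm, ← sub_smul, norm_smul, hu]
  exact h.isCompact_preimage hK

lemma convex_fibre (hc : Convex ℝ K) (y : EuclideanSpace ℝ (Fin n)) :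
    Convex ℝ {s : ℝ | y + s • u ∈ K} := by
  intro a ha b hb p q hp hq hpq
  have h := hc ha hb hp hq hpq
  have e : p • (y + a • u) + q • (y + b • u) = y + (p • a + q • b) • u := by
    have : y = (p + q) • y := by rw [hpq, one_smul]
    conv_rhs => rw [this]
    simp only [smul_eq_mul]
    module
  rwa [e] at h

lemma fibre_eq_Icc (hu : ‖u‖ = 1) (hK : IsCompact K) (hc : Convex ℝ K)
    (y : EuclideanSpace ℝ (Fin n)) (hne : ∃ s : ℝ, y + s • u ∈ K) :
    ∃ a b : ℝ, a ≤ b ∧ {s : ℝ | y + s • u ∈ K} = Set.Icc a b := by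
  have h1 : IsConnected {s : ℝ | y + s • u ∈ K} := ⟨hne, (convex_fibre hc y).isPreconnected⟩
  have h2 := eq_Icc_of_connected_compact h1 (isCompact_fibre hu hK y)
  refine ⟨_, _, ?_, h2⟩
  rw [← Set.nonempty_Icc, ← h2]
  exact hne

lemma mem_orthogonal_span_iff {y : EuclideanSpace ℝ (Fin n)} : y ∈ (ℝ ∙ u)ᗮ ↔ ⟪u, y⟫ = 0 :=
  Submodule.mem_orthogonal_singleton_iff_inner_right

/-- For convex bodies, the Steiner symmetral is the set of half-differences along chords. -/
lemma mem_steinerSymmetral_iff (hu : ‖u‖ = 1) (hK : IsCompact K) (hc : Convex ℝ K)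
    {z : EuclideanSpace ℝ (Fin n)} :
    z ∈ steinerSymmetral u K ↔ ∃ (y : EuclideanSpace ℝ (Fin n)) (s t : ℝ), ⟪u, y⟫ = 0 ∧
      y + s • u ∈ K ∧ y + t • u ∈ K ∧ z = y + ((s - t) / 2) • u := by
  constructor
  · rintro ⟨y, t, hy, rfl, hne, ht⟩
    obtain ⟨a, b, hab, hF⟩ := fibre_eq_Icc hu hK hc y hne
    rw [hF, Real.volume_Icc, ENNReal.toReal_ofReal (by linarith), abs_le] at ht
    have hm : ∀ s ∈ Set.Icc a b, y + s • u ∈ K := fun s hs => by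
      rw [← hF] at hs; exact hs
    refine ⟨y, (a + b) / 2 + t, (a + b) / 2 - t, mem_orthogonal_span_iff.1 hy, hm _ ?_, hm _ ?_, ?_⟩
    · constructor <;> linarith
    · constructor <;> linarith
    · congr 2; ring
  · rintro ⟨y, s, t, hy, hs, ht, rfl⟩
    obtain ⟨a, b, hab, hF⟩ := fibre_eq_Icc hu hK hc y ⟨s, hs⟩
    refine ⟨y, _, mem_orthogonal_span_iff.2 hy, rfl, ⟨s, hs⟩, ?_⟩
    have hs' : s ∈ Set.Icc a b := hF ▸ hs
    have ht' : t ∈ Set.Icc a b := hF ▸ ht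
    rw [hF, Real.volume_Icc, ENNReal.toReal_ofReal (by linarith), abs_le]
    constructor <;> linarith [hs'.1, hs'.2, ht'.1, ht'.2]

lemma inner_self_of_norm_one (hu : ‖u‖ = 1) : ⟪u, u⟫ = 1 := by
  rw [real_inner_self_eq_norm_sq, hu]; norm_num

/-- The Steiner symmetral is a linear image of the pairs of points on common chords. -/
lemma steinerSymmetral_eq_image (hu : ‖u‖ = 1) (hK : IsCompact K) (hc : Convex ℝ K) :
    steinerSymmetral u K =
      (fun p : EuclideanSpace ℝ (Fin n) × EuclideanSpace ℝ (Fin n) =>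
        (p.1 - ⟪u, p.1⟫ • u) + ((⟪u, p.1⟫ - ⟪u, p.2⟫) / 2) • u) ''
      ((K ×ˢ K) ∩ {p | p.1 - ⟪u, p.1⟫ • u = p.2 - ⟪u, p.2⟫ • u}) := by
  have huu := inner_self_of_norm_one hu
  ext z
  rw [mem_steinerSymmetral_iff hu hK hc]
  constructor
  · rintro ⟨y, s, t, hy, hs, ht, rfl⟩
    refine ⟨(y + s • u, y + t • u), ⟨⟨hs, ht⟩, ?_⟩, ?_⟩ <;>
    simp [inner_add_right, inner_smul_right, hy, hu]
  · rintro ⟨⟨x, x'⟩, ⟨⟨hx, hx'⟩, he⟩, rfl⟩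
    simp only [Set.mem_ofPred_eq] at he
    refine ⟨x - ⟪u, x⟫ • u, ⟪u, x⟫, ⟪u, x'⟫, ?_, ?_, ?_, rfl⟩
    · simp [inner_sub_right, inner_smul_right, hu]
    · simpa using hx
    · rw [he]; simpa using hx'

lemma isCompact_steinerSymmetral (hu : ‖u‖ = 1) (hK : IsCompact K) (hc : Convex ℝ K) :
    IsCompact (steinerSymmetral u K) := by
  rw [steinerSymmetral_eq_image hu hK hc]
  refine IsCompact.image ((hK.prod hK).inter_right ?_) (by fun_prop)
  exact isClosed_eq (by fun_prop) (by fun_prop)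

lemma convex_steinerSymmetral (hu : ‖u‖ = 1) (hK : IsCompact K) (hc : Convex ℝ K) :
    Convex ℝ (steinerSymmetral u K) := by
  intro z hz z' hz' p q hp hq hpq
  rw [mem_steinerSymmetral_iff hu hK hc] at hz hz' ⊢
  obtain ⟨y, s, t, hy, hs, ht, rfl⟩ := hz
  obtain ⟨y', s', t', hy', hs', ht', rfl⟩ := hz'
  refine ⟨p • y + q • y', p * s + q * s', p * t + q * t', ?_, ?_, ?_, ?_⟩
  · simp [inner_add_right, inner_smul_right, hy, hy']
  · convert! hc hs hs' hp hq hpq using 1; module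
  · convert! hc ht ht' hp hq hpq using 1; module
  · module

lemma reflection_apply_of_norm_one (hu : ‖u‖ = 1) (x : EuclideanSpace ℝ (Fin n)) :
    (ℝ ∙ u)ᗮ.reflection x = x - (2 * ⟪u, x⟫) • u := by
  rw [Submodule.reflection_orthogonal_apply, Submodule.reflection_singleton_apply]
  simp [hu]
  module

lemma reflection_line (hu : ‖u‖ = 1) {y : EuclideanSpace ℝ (Fin n)} (hy : ⟪u, y⟫ = 0) (s : ℝ) :
    (ℝ ∙ u)ᗮ.reflection (y + s • u) = y + (-s) • u := by
  rw [reflection_apply_of_norm_one hu]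
  simp [inner_add_right, inner_smul_right, hy, hu]
  module

lemma reflection_mem_steinerSymmetral (hu : ‖u‖ = 1) (hK : IsCompact K) (hc : Convex ℝ K)
    {z : EuclideanSpace ℝ (Fin n)} (hz : z ∈ steinerSymmetral u K) :
    (ℝ ∙ u)ᗮ.reflection z ∈ steinerSymmetral u K := by
  rw [mem_steinerSymmetral_iff hu hK hc] at hz ⊢
  obtain ⟨y, s, t, hy, hs, ht, rfl⟩ := hz
  refine ⟨y, t, s, hy, ht, hs, ?_⟩
  rw [reflection_line hu hy]
  congr 2; ring

lemma reflection_mem_steinerSymmetral_of_orthogonal (hu : ‖u‖ = 1) (hK : IsCompact K)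
    (hc : Convex ℝ K) {v : EuclideanSpace ℝ (Fin n)} (hv : ‖v‖ = 1) (huv : ⟪u, v⟫ = 0)
    (hsym : ∀ x ∈ K, (ℝ ∙ v)ᗮ.reflection x ∈ K)
    {z : EuclideanSpace ℝ (Fin n)} (hz : z ∈ steinerSymmetral u K) :
    (ℝ ∙ v)ᗮ.reflection z ∈ steinerSymmetral u K := by
  have hvu : (ℝ ∙ v)ᗮ.reflection u = u := by
    rw [reflection_apply_of_norm_one hv, real_inner_comm, huv]; simp
  rw [mem_steinerSymmetral_iff hu hK hc] at hz ⊢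
  obtain ⟨y, s, t, hy, hs, ht, rfl⟩ := hz
  refine ⟨(ℝ ∙ v)ᗮ.reflection y, s, t, ?_, ?_, ?_, ?_⟩
  · rw [reflection_apply_of_norm_one hv]; simp [inner_sub_right, inner_smul_right, hy, huv]
  · simpa [hvu] using hsym _ hs
  · simpa [hvu] using hsym _ ht
  · simp [hvu]

lemma closedBall_subset_steinerSymmetral (hu : ‖u‖ = 1) (hK : IsCompact K) (hc : Convex ℝ K)
    {r : ℝ} (h : closedBall 0 r ⊆ K) : closedBall 0 r ⊆ steinerSymmetral u K := by
  intro z hz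
  rw [mem_steinerSymmetral_iff hu hK hc]
  have hy : ⟪u, z - ⟪u, z⟫ • u⟫ = 0 := by
    simp [inner_sub_right, inner_smul_right, hu]
  have e : z = (z - ⟪u, z⟫ • u) + ⟪u, z⟫ • u := by module
  refine ⟨z - ⟪u, z⟫ • u, ⟪u, z⟫, -⟪u, z⟫, hy, ?_, ?_, ?_⟩
  · rw [← e]; exact h hz
  · rw [← reflection_line hu hy, ← e]
    apply h
    simpa using hz
  · module

end Structure

section Fubini

variable {n : ℕ} {u : EuclideanSpace ℝ (Fin n)} {K : Set (EuclideanSpace ℝ (Fin n))}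

lemma measurePreserving_line (hu : ‖u‖ = 1) :
    MeasurePreserving (fun p : ℝ × (ℝ ∙ u)ᗮ => (p.2 : EuclideanSpace ℝ (Fin n)) + p.1 • u) := by
  have h1 := ((LinearIsometryEquiv.toSpanUnitSingleton (𝕜 := ℝ) u hu).measurePreserving).prod
    (MeasurePreserving.id (volume : Measure (ℝ ∙ u)ᗮ))
  have h2 := (ℝ ∙ u).orthogonalDecomposition.symm.measurePreserving.comp
    ((WithLp.volume_preserving_toLp (ℝ ∙ u) (ℝ ∙ u)ᗮ).comp h1)
  convert! h2 using 1
  ext1 p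
  simp [add_comm]

lemma lintegral_eq_lintegral_line (hu : ‖u‖ = 1) {f : EuclideanSpace ℝ (Fin n) → ENNReal}
    (hf : Measurable f) :
    ∫⁻ x, f x = ∫⁻ y : (ℝ ∙ u)ᗮ, ∫⁻ s : ℝ, f (y + s • u) := by
  have h := measurePreserving_line hu
  rw [← h.lintegral_comp hf]
  exact lintegral_prod_symm' _ (hf.comp h.measurable)

lemma measurable_line (y : EuclideanSpace ℝ (Fin n)) : Measurable fun s : ℝ => y + s • u := by
  fun_prop

lemma measurableSet_line (y : EuclideanSpace ℝ (Fin n)) {A : Set (EuclideanSpace ℝ (Fin n))}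
    (hA : MeasurableSet A) : MeasurableSet {s : ℝ | y + s • u ∈ A} :=
  measurable_line y hA

lemma measurable_lintegral_line {f : EuclideanSpace ℝ (Fin n) → ENNReal}
    (hf : Measurable f) : Measurable fun y : (ℝ ∙ u)ᗮ => ∫⁻ s : ℝ, f (y + s • u) :=
  Measurable.lintegral_prod_right' (f := fun p : (ℝ ∙ u)ᗮ × ℝ => f (p.1 + p.2 • u))
    (hf.comp (by fun_prop))

lemma setLIntegral_eq_lintegral_line (hu : ‖u‖ = 1) {f : EuclideanSpace ℝ (Fin n) → ENNReal}
    (hf : Measurable f) {A : Set (EuclideanSpace ℝ (Fin n))} (hA : MeasurableSet A) :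
    ∫⁻ x in A, f x = ∫⁻ y : (ℝ ∙ u)ᗮ, ∫⁻ s in {s : ℝ | y + s • u ∈ A}, f (y + s • u) := by
  rw [← lintegral_indicator hA, lintegral_eq_lintegral_line hu (hf.indicator hA)]
  refine lintegral_congr fun y => ?_
  rw [← lintegral_indicator (measurableSet_line (y : EuclideanSpace ℝ (Fin n)) hA)]
  rfl

lemma measurable_setLIntegral_line {f : EuclideanSpace ℝ (Fin n) → ENNReal}
    (hf : Measurable f) {A : Set (EuclideanSpace ℝ (Fin n))} (hA : MeasurableSet A) :
    Measurable fun y : (ℝ ∙ u)ᗮ => ∫⁻ s in {s : ℝ | y + s • u ∈ A}, f (y + s • u) := by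
  convert! measurable_lintegral_line (u := u) (hf.indicator hA) using 2 with y
  rw [← lintegral_indicator (measurableSet_line (y : EuclideanSpace ℝ (Fin n)) hA)]
  rfl

lemma volume_eq_lintegral_line (hu : ‖u‖ = 1) {A : Set (EuclideanSpace ℝ (Fin n))}
    (hA : MeasurableSet A) :
    volume A = ∫⁻ y : (ℝ ∙ u)ᗮ, volume {s : ℝ | y + s • u ∈ A} := by
  have h := setLIntegral_eq_lintegral_line hu (measurable_const (a := (1 : ENNReal))) hA
  simpa using h

lemma measurable_volume_line {A : Set (EuclideanSpace ℝ (Fin n))}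
    (hA : MeasurableSet A) :
    Measurable fun y : (ℝ ∙ u)ᗮ => volume {s : ℝ | y + s • u ∈ A} := by
  have h := measurable_setLIntegral_line (u := u) (measurable_const (a := (1 : ENNReal))) hA
  simpa using h

lemma steinerSymmetral_line (hu : ‖u‖ = 1) {y : EuclideanSpace ℝ (Fin n)} (hy : ⟪u, y⟫ = 0) :
    {s : ℝ | y + s • u ∈ steinerSymmetral u K} = {s : ℝ | (∃ t : ℝ, y + t • u ∈ K) ∧
      |s| ≤ (volume {t : ℝ | y + t • u ∈ K}).toReal / 2} := by
  ext s
  constructor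
  · rintro ⟨y', t, hy', he, h⟩
    rw [mem_orthogonal_span_iff] at hy'
    have hst : s = t := by
      have := congrArg (fun z => ⟪u, z⟫) he
      simpa [inner_add_right, inner_smul_right, hy, hy', hu] using this
    subst hst
    obtain rfl : y = y' := add_right_cancel he
    exact h
  · rintro h
    exact ⟨y, s, mem_orthogonal_span_iff.2 hy, rfl, h⟩

lemma steinerSymmetral_line_of_eq_Icc (hu : ‖u‖ = 1) {y : EuclideanSpace ℝ (Fin n)}
    (hy : ⟪u, y⟫ = 0) {a b : ℝ} (hab : a ≤ b) (h : {s : ℝ | y + s • u ∈ K} = Set.Icc a b) :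
    {s : ℝ | y + s • u ∈ steinerSymmetral u K} = Set.Icc (-((b - a) / 2)) ((b - a) / 2) := by
  have hne : ∃ t : ℝ, y + t • u ∈ K := by
    have : a ∈ {s : ℝ | y + s • u ∈ K} := by rw [h]; exact Set.left_mem_Icc.2 hab
    exact ⟨a, this⟩
  rw [steinerSymmetral_line hu hy, h, Real.volume_Icc, ENNReal.toReal_ofReal (by linarith)]
  ext s
  rw [Set.mem_Icc, ← abs_le]
  simp [hne]

lemma volume_steinerSymmetral (hu : ‖u‖ = 1) (hK : IsCompact K) (hc : Convex ℝ K) :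
    volume (steinerSymmetral u K) = volume K := by
  rw [volume_eq_lintegral_line hu (isCompact_steinerSymmetral hu hK hc).measurableSet,
    volume_eq_lintegral_line hu hK.measurableSet]
  refine lintegral_congr fun y => ?_
  have hy : ⟪u, (y : EuclideanSpace ℝ (Fin n))⟫ = 0 := mem_orthogonal_span_iff.1 y.2
  by_cases hne : ∃ s : ℝ, (y : EuclideanSpace ℝ (Fin n)) + s • u ∈ K
  · obtain ⟨a, b, hab, hF⟩ := fibre_eq_Icc hu hK hc y hne
    rw [steinerSymmetral_line_of_eq_Icc hu hy hab hF, hF, Real.volume_Icc, Real.volume_Icc]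
    congr 1; ring
  · rw [steinerSymmetral_line hu hy]
    push Not at hne
    simp [hne]

lemma setLIntegral_Icc_quadratic {a b c Y : ℝ} (hab : a ≤ b) (hc : 0 ≤ c) (hY : 0 ≤ Y) :
    ∫⁻ s in Set.Icc a b, ENNReal.ofReal (c * (Y + s ^ 2)) =
      ENNReal.ofReal (c * (Y * (b - a) + (b ^ 3 - a ^ 3) / 3)) := by
  rw [← ofReal_integral_eq_lintegral_ofReal]
  · congr 1
    rw [integral_Icc_eq_integral_Ioc, ← intervalIntegral.integral_of_le hab,
      intervalIntegral.integral_const_mul, intervalIntegral.integral_add (by simp) (by simp),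
      intervalIntegral.integral_const, integral_pow]
    simp; ring_nf; simp
  · exact (Continuous.integrableOn_Icc (by fun_prop))
  · exact Filter.Eventually.of_forall fun s => by positivity

lemma volume_Icc_diff_neg_le (a b : ℝ) :
    volume (Set.Icc a b \ {s | -s ∈ Set.Icc a b}) ≤ ENNReal.ofReal |a + b| := by
  rcases le_total 0 (a + b) with h | h
  · rw [abs_of_nonneg h]
    calc _ ≤ volume (Set.Icc (-a) b) := measure_mono ?_
      _ = _ := by rw [Real.volume_Icc]; congr 1; ring
    rintro s ⟨hs, hs'⟩
    have : ¬ (a ≤ -s ∧ -s ≤ b) := hs'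
    refine ⟨?_, hs.2⟩
    by_contra! hlt
    exact this ⟨by linarith, by linarith [hs.1]⟩
  · rw [abs_of_nonpos h]
    calc _ ≤ volume (Set.Icc a (-b)) := measure_mono ?_
      _ = _ := by rw [Real.volume_Icc]; congr 1; ring
    rintro s ⟨hs, hs'⟩
    have : ¬ (a ≤ -s ∧ -s ≤ b) := hs'
    refine ⟨hs.1, ?_⟩
    by_contra! hlt
    exact this ⟨by linarith [hs.2], by linarith⟩

lemma interval_asymmetry_le {a b η τ Y : ℝ} (hab : a ≤ b) (hη : 0 < η) (hτ : 0 < τ) (hY : 0 ≤ Y)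
    {G : Set ℝ} (hG : b - a < τ → G = ∅) :
    volume (Set.Icc a b \ {s | -s ∈ Set.Icc a b}) +
      ∫⁻ s in Set.Icc (-((b - a) / 2)) ((b - a) / 2),
        ENNReal.ofReal (1 / (η * τ ^ 2) * (Y + s ^ 2)) ≤
    volume (Set.Icc a b \ G) + ENNReal.ofReal η * volume (Set.Icc a b) +
      ∫⁻ s in Set.Icc a b, ENNReal.ofReal (1 / (η * τ ^ 2) * (Y + s ^ 2)) := by
  set c := 1 / (η * τ ^ 2) with hcdef
  have hc : 0 < c := by positivity
  rw [setLIntegral_Icc_quadratic (by linarith) hc.le hY, setLIntegral_Icc_quadratic hab hc.le hY]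
  set m := (a + b) / 2 with hm
  have key : c * (Y * (b - a) + (b ^ 3 - a ^ 3) / 3) =
      c * (Y * ((b - a) / 2 - -((b - a) / 2)) + (((b - a) / 2) ^ 3 - (-((b - a) / 2)) ^ 3) / 3) +
        c * ((b - a) * m ^ 2) := by rw [hm]; ring
  have hpos : 0 ≤ c * ((b - a) * m ^ 2) := by
    have : 0 ≤ b - a := by linarith
    positivity
  have hnn : 0 ≤ c * (Y * ((b - a) / 2 - -((b - a) / 2)) +
      (((b - a) / 2) ^ 3 - (-((b - a) / 2)) ^ 3) / 3) := by
    have : 0 ≤ b - a := by linarith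
    have : (((b - a) / 2) ^ 3 - (-((b - a) / 2)) ^ 3) / 3 = (b - a) ^ 3 / 12 := by ring
    rw [this]
    have : (b - a) / 2 - -((b - a) / 2) = b - a := by ring
    rw [this]
    positivity
  rw [key, ENNReal.ofReal_add hnn hpos]
  set Q := ENNReal.ofReal (c * (Y * ((b - a) / 2 - -((b - a) / 2)) +
      (((b - a) / 2) ^ 3 - (-((b - a) / 2)) ^ 3) / 3))
  rw [add_comm Q, ← add_assoc]
  gcongr
  rcases lt_or_ge (b - a) τ with h | h
  · rw [hG h, add_assoc]
    refine le_add_right (measure_mono ?_)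
    simp
  · refine (volume_Icc_diff_neg_le a b).trans ?_
    rw [Real.volume_Icc, ← ENNReal.ofReal_mul hη.le, add_assoc,
      ← ENNReal.ofReal_add (by apply mul_nonneg hη.le; linarith) hpos]
    refine le_add_left (ENNReal.ofReal_le_ofReal ?_)
    have h2 : |a + b| = 2 * |m| := by
      rw [hm, abs_div, abs_two]; ring
    have h3 : 2 * |m| ≤ (b - a) * (2 * |m| / τ) := by
      rw [mul_div_assoc', le_div_iff₀ hτ]
      have := abs_nonneg m
      nlinarith
    have h4 : 2 * |m| / τ ≤ η + c * m ^ 2 := by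
      have e : c * m ^ 2 = η * (|m| / (η * τ)) ^ 2 := by
        rw [hcdef, div_pow |m|, sq_abs]; field_simp
      have e2 : 2 * |m| / τ = η * (2 * (|m| / (η * τ))) := by field_simp
      rw [e, e2]
      nlinarith [mul_nonneg hη.le (sq_nonneg (|m| / (η * τ) - 1))]
    calc |a + b| ≤ (b - a) * (η + c * m ^ 2) := by
          rw [h2]
          refine h3.trans (mul_le_mul_of_nonneg_left h4 (by linarith))
      _ = _ := by ring

lemma measurable_ofReal_norm_sq (c : ℝ) :
    Measurable fun x : EuclideanSpace ℝ (Fin n) => ENNReal.ofReal (c * ‖x‖ ^ 2) := by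
  fun_prop

/-- If `K` contains a ball of radius `ρ`, then a Steiner symmetrization that moves a lot of volume
substantially decreases the second moment. -/
lemma reflection_asymmetry_le (hu : ‖u‖ = 1) (hK : IsCompact K) (hc : Convex ℝ K) {ρ t η : ℝ}
    (hρ : 0 < ρ) (hball : closedBall 0 ρ ⊆ K) (ht0 : 0 < t) (ht1 : t < 1) (hη : 0 < η) :
    volume (K \ (ℝ ∙ u)ᗮ.reflection ⁻¹' K) +
      ∫⁻ x in steinerSymmetral u K, ENNReal.ofReal (1 / (η * (2 * t * ρ) ^ 2) * ‖x‖ ^ 2) ≤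
    volume (K \ (1 - t) • K) + ENNReal.ofReal η * volume K +
      ∫⁻ x in K, ENNReal.ofReal (1 / (η * (2 * t * ρ) ^ 2) * ‖x‖ ^ 2) := by
  have hKm := hK.measurableSet
  have hSm := (isCompact_steinerSymmetral hu hK hc).measurableSet
  have hRm : MeasurableSet (K \ (ℝ ∙ u)ᗮ.reflection ⁻¹' K) :=
    hKm.diff ((ℝ ∙ u)ᗮ.reflection.continuous.measurable hKm)
  have hTm : MeasurableSet (K \ (1 - t) • K) := hKm.diff (hK.smul _).measurableSet
  have hf := measurable_ofReal_norm_sq (n := n) (1 / (η * (2 * t * ρ) ^ 2))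
  rw [volume_eq_lintegral_line hu hRm, volume_eq_lintegral_line hu hTm,
    volume_eq_lintegral_line hu hKm, setLIntegral_eq_lintegral_line hu hf hKm,
    setLIntegral_eq_lintegral_line hu hf hSm,
    ← lintegral_const_mul _ (measurable_volume_line hKm),
    ← lintegral_add_left (measurable_volume_line hRm),
    ← lintegral_add_left (measurable_volume_line hTm),
    ← lintegral_add_right _ (measurable_setLIntegral_line hf hKm)]
  refine lintegral_mono fun ⟨y, hy'⟩ => ?_
  have hy : ⟪u, y⟫ = 0 := mem_orthogonal_span_iff.1 hy'
  have hnorm : ∀ s : ℝ, ‖y + s • u‖ ^ 2 = ‖y‖ ^ 2 + s ^ 2 := fun s => by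
    rw [norm_add_sq_real, inner_smul_right, real_inner_comm, hy, norm_smul, hu]
    simp
  have hR : {s : ℝ | y + s • u ∈ K \ (ℝ ∙ u)ᗮ.reflection ⁻¹' K} =
      {s : ℝ | y + s • u ∈ K} \ {s : ℝ | -s ∈ {s : ℝ | y + s • u ∈ K}} := by
    ext s
    change (_ ∈ K ∧ ¬ ((ℝ ∙ u)ᗮ.reflection (y + s • u) ∈ K)) ↔ _
    rw [reflection_line hu hy]
    rfl
  have hT : {s : ℝ | y + s • u ∈ K \ (1 - t) • K} =
      {s : ℝ | y + s • u ∈ K} \ {s : ℝ | y + s • u ∈ (1 - t) • K} := rfl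
  simp only [hnorm]
  rw [hR, hT]
  by_cases hne : ∃ s : ℝ, y + s • u ∈ K
  · obtain ⟨a, b, hab, hF⟩ := fibre_eq_Icc hu hK hc y hne
    rw [steinerSymmetral_line_of_eq_Icc hu hy hab hF, hF]
    refine interval_asymmetry_le hab hη (by positivity) (sq_nonneg _) fun hlt => ?_
    rw [Set.eq_empty_iff_forall_notMem]
    rintro s ⟨x, hx, hxe⟩
    simp only at hxe
    have hmem : ∀ v : ℝ, |v| ≤ ρ → s + t * v ∈ Set.Icc a b := fun v hv => by
      rw [← hF]
      have hv' : v • u ∈ K := hball (by simpa [norm_smul, hu] using hv)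
      have := hc hx hv' (by linarith : 0 ≤ 1 - t) ht0.le (by ring)
      rw [hxe] at this
      have e : y + (s + t * v) • u = y + s • u + t • v • u := by module
      change y + (s + t * v) • u ∈ K
      rwa [e]
    have h1 := (hmem ρ (by rw [abs_of_pos hρ])).2
    have h2 := (hmem (-ρ) (by rw [abs_neg, abs_of_pos hρ])).1
    linarith
  · have hempty : {s : ℝ | y + s • u ∈ steinerSymmetral u K} = ∅ := by
      rw [steinerSymmetral_line hu hy]
      push Not at hne
      simp [hne]
    have hempty' : {s : ℝ | y + s • u ∈ K} = ∅ := by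
      push Not at hne
      simp [hne]
    rw [hempty, hempty']
    simp

lemma volume_diff_smul_le (hK : IsCompact K) (hc : Convex ℝ K)
    (h0 : (0 : EuclideanSpace ℝ (Fin n)) ∈ K)
    {t : ℝ} (ht0 : 0 ≤ t) (ht1 : t ≤ 1) :
    volume (K \ (1 - t) • K) ≤ ENNReal.ofReal (n * t) * volume K := by
  have hsub : (1 - t) • K ⊆ K := by
    rintro _ ⟨x, hx, rfl⟩
    exact hc.smul_mem_of_zero_mem h0 hx ⟨by linarith, by linarith⟩
  have hv : volume ((1 - t) • K) = ENNReal.ofReal ((1 - t) ^ n) * volume K := by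
    rw [Measure.addHaar_smul, abs_of_nonneg (by simp; bound)]
    simp
  have hfin : volume ((1 - t) • K) ≠ ⊤ := (hK.smul _).measure_ne_top
  rw [measure_sdiff hsub (hK.smul _).measurableSet.nullMeasurableSet hfin]
  refine tsub_le_iff_right.2 ?_
  rw [hv, ← add_mul, ← ENNReal.ofReal_add (by positivity) (by bound)]
  have hb := one_add_mul_le_pow (a := -t) (by linarith) n
  refine le_mul_of_one_le_left zero_le (ENNReal.one_le_ofReal.2 ?_)
  rw [sub_eq_add_neg 1 t]
  linarith

end Fubini

lemma measure_diff_eq_of_measure_eq {E : Type*} [MeasurableSpace E] {ν : Measure E} {A B : Set E}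
    (hA : MeasurableSet A)
    (hB : MeasurableSet B) (hfin : ν A ≠ ⊤) (h : ν A = ν B) :
    ν (A \ B) = ν (B \ A) := by
  have h1 := measure_inter_add_sdiff (μ := ν) A hB
  have h2 := measure_inter_add_sdiff (μ := ν) B hA
  rw [Set.inter_comm B A, ← h, ← h1] at h2
  exact ((ENNReal.add_right_inj (ne_top_of_le_ne_top hfin (measure_mono Set.inter_subset_left))).1
    h2).symm

section Rotations

variable {E : Type*} [NormedAddCommGroup E] [InnerProductSpace ℝ E] [FiniteDimensional ℝ E]
  [MeasurableSpace E] [BorelSpace E]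

instance compactSpace_unitary :
    CompactSpace (unitary (E →L[ℝ] E)) := by
  refine (isCompact_iff_compactSpace (X := E →L[ℝ] E)).1 ?_
  refine Metric.isCompact_of_isClosed_isBounded isClosed_unitary ?_
  refine (Metric.isBounded_closedBall (x := 0) (r := 1)).subset fun f hf => ?_
  rw [mem_closedBall_zero_iff]
  refine ContinuousLinearMap.opNorm_le_bound _ zero_le_one fun x => ?_
  rw [one_mul]
  exact (Unitary.norm_map (⟨f, hf⟩ : unitary _) x).le

/-- A star-shaped set with the measure of the unit ball that is nearly invariant under all
isometries is close to the unit ball. -/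
lemma measure_diff_closedBall_le [Nontrivial E] {ν : Measure E} [IsFiniteMeasureOnCompacts ν]
    {B : ENNReal} {K : Set E} (hν : ∀ g : E ≃ₗᵢ[ℝ] E, MeasurePreserving g ν ν)
    (hK : IsCompact K)
    (h0 : (0 : E) ∈ K)
    (hstar : ∀ x ∈ K, ∀ t : ℝ, 0 ≤ t → t ≤ 1 → t • x ∈ K)
    (hvol : ν K = ν (closedBall (0 : E) 1))
    (h : ∀ g : E ≃ₗᵢ[ℝ] E,
      ν (K \ g ⁻¹' K) ≤ B) :
    ν (K \ closedBall 0 1) ≤ 2 * B := by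
  let _ : MeasurableSpace (unitary (E →L[ℝ] E)) := borel (unitary (E →L[ℝ] E))
  have : BorelSpace (unitary (E →L[ℝ] E)) := ⟨rfl⟩
  let μ : Measure (unitary (E →L[ℝ] E)) := Measure.haarMeasure ⊤
  have hμ : μ Set.univ = 1 := Measure.haarMeasure_self
    (K₀ := (⊤ : TopologicalSpace.PositiveCompacts (unitary (E →L[ℝ] E))))
  have : IsProbabilityMeasure μ := ⟨hμ⟩
  have hKm := hK.measurableSet
  have hcont : Continuous fun p : E × unitary (E →L[ℝ] E) =>
      (star p.2 : E →L[ℝ] E) p.1 := by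
    fun_prop
  let act : unitary (E →L[ℝ] E) → E → E := fun g x =>
    (star g : E →L[ℝ] E) x
  have hin : MeasurableSet {p : E × unitary (E →L[ℝ] E) | act p.2 p.1 ∈ K} :=
    hcont.measurable hKm
  have hsec : ∀ x, MeasurableSet {g : unitary (E →L[ℝ] E) | act g x ∈ K} := fun x =>
    (measurable_prodMk_left (x := x)) hin
  let p : E → ENNReal := fun x => μ {g : unitary (E →L[ℝ] E) | act g x ∈ K}
  let q : E → ENNReal := fun x => μ {g : unitary (E →L[ℝ] E) | act g x ∉ K}
  have hpq : ∀ x, p x + q x = 1 := fun x => by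
    rw [← hμ]; exact measure_add_measure_compl (hsec x)
  have hinv : ∀ x y : E, ‖x‖ = ‖y‖ → p x = p y := by
    intro x y hxy
    let k : unitary (E →L[ℝ] E) := Unitary.linearIsometryEquiv.symm (ℝ ∙ (x - y))ᗮ.reflection
    have hkx : (k : E →L[ℝ] E) x = y :=
      Submodule.reflection_sub hxy
    have : {g : unitary (E →L[ℝ] E) | act g y ∈ K} =
        (fun g => k⁻¹ * g) ⁻¹' {g : unitary (E →L[ℝ] E) | act g x ∈ K} := by
      ext g
      have : act (k⁻¹ * g) x = act g y := by
        rw [← hkx]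
        simp only [act, ← Unitary.star_eq_inv, Submonoid.coe_mul, Unitary.coe_star, star_mul,
          star_star]
        rfl
      simp [this]
    change μ _ = μ _
    rw [this, measure_preimage_mul]
  obtain ⟨e, he⟩ : ∃ e : E, ‖e‖ = 1 := exists_norm_eq E zero_le_one
  have hqinv : ∀ x, ‖x‖ = 1 → q x = q e := by
    intro x hx
    have h1 := hpq x
    rw [hinv x e (hx.trans he.symm), ← hpq e] at h1
    exact (ENNReal.add_right_inj (measure_ne_top _ _)).1 h1
  have hactsmul : ∀ g (t : ℝ) x, act g (t • x) = t • act g x := fun g t x => by simp [act]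
  have hq : ∀ x ∈ K \ closedBall 0 1, q e ≤ q x := by
    rintro x ⟨-, hx⟩
    have hx1 : 1 < ‖x‖ := by simpa using hx
    rw [← hqinv (‖x‖⁻¹ • x) (norm_smul_inv_norm (𝕜 := ℝ) (norm_pos_iff.1 (by linarith)))]
    refine measure_mono fun g (hg : act g (‖x‖⁻¹ • x) ∉ K) hgx => hg ?_
    rw [hactsmul]
    exact hstar _ hgx _ (by positivity) (inv_le_one_of_one_le₀ hx1.le)
  have hp : ∀ x ∈ closedBall 0 1 \ K, p e ≤ p x := by
    rintro x ⟨hx, hxK⟩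
    have hx1 : ‖x‖ ≤ 1 := by simpa using hx
    have hx0 : x ≠ 0 := fun hx0 => hxK (hx0 ▸ h0)
    have hxn : ‖x‖ ≠ 0 := norm_ne_zero_iff.2 hx0
    rw [hinv e (‖x‖⁻¹ • x) (by rw [he]; exact (norm_smul_inv_norm (𝕜 := ℝ) hx0).symm)]
    refine measure_mono fun g (hg : act g (‖x‖⁻¹ • x) ∈ K) => ?_
    have := hstar _ hg ‖x‖ (norm_nonneg _) hx1
    rw [hactsmul, smul_smul, mul_inv_cancel₀ hxn, one_smul] at this
    exact this
  have hbound : ∀ {S : Set (E × unitary (E →L[ℝ] E))}, MeasurableSet S →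
      (∀ g, ν ((fun x => (x, g)) ⁻¹' S) ≤ B) →
      ∫⁻ x, μ (Prod.mk x ⁻¹' S) ∂ν ≤ B := by
    intro S hS hB
    rw [← Measure.prod_apply hS, Measure.prod_apply_symm hS]
    calc _ ≤ ∫⁻ _ : unitary (E →L[ℝ] E), B ∂μ := lintegral_mono hB
      _ = B := by simp [hμ]
  have hball : MeasurableSet (closedBall (0 : E) 1) := measurableSet_closedBall
  have h1 : q e * ν (K \ closedBall 0 1) ≤ B := by
    have hS : MeasurableSet {p : E × unitary (E →L[ℝ] E) | p.1 ∈ K ∧ act p.2 p.1 ∉ K} :=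
      (measurable_fst hKm).inter hin.compl
    refine le_trans ?_ (hbound hS fun g => h (Unitary.linearIsometryEquiv (star g)))
    rw [← setLIntegral_const]
    refine le_trans (setLIntegral_mono' (hKm.diff hball) fun x hx => ?_)
      (setLIntegral_le_lintegral _ _)
    refine (hq x hx).trans (measure_mono fun g hg => ⟨hx.1, hg⟩)
  have h2 : p e * ν (closedBall 0 1 \ K) ≤ B := by
    have hS : MeasurableSet {p : E × unitary (E →L[ℝ] E) | p.1 ∉ K ∧ act p.2 p.1 ∈ K} :=
      (measurable_fst hKm.compl).inter hin
    refine le_trans ?_ (hbound hS fun g => ?_)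
    · rw [← setLIntegral_const]
      refine le_trans (setLIntegral_mono' (hball.diff hKm) fun x hx => ?_)
        (setLIntegral_le_lintegral _ _)
      refine (hp x hx).trans (measure_mono fun g hg => ⟨hx.2, hg⟩)
    · set k := Unitary.linearIsometryEquiv (star g)
      have : (fun x => (x, g)) ⁻¹' {p : E × unitary (E →L[ℝ] E) | p.1 ∉ K ∧ act p.2 p.1 ∈ K} =
          k ⁻¹' (K \ k.symm ⁻¹' K) := by
        ext x
        change (x ∉ K ∧ k x ∈ K) ↔ (k x ∈ K ∧ k.symm (k x) ∉ K)
        rw [k.symm_apply_apply, and_comm]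
      rw [this, (hν k).measure_preimage (hKm.diff
        (k.symm.continuous.measurable hKm)).nullMeasurableSet]
      exact h _
  rw [← measure_diff_eq_of_measure_eq hKm hball hK.measure_ne_top hvol] at h2
  calc ν (K \ closedBall 0 1) = (p e + q e) * ν (K \ closedBall 0 1) := by
        rw [hpq, one_mul]
    _ ≤ B + B := by rw [add_mul]; exact add_le_add h2 h1
    _ = 2 * B := by rw [two_mul]

end Rotations

section Isometries

variable {n : ℕ} {K : Set (EuclideanSpace ℝ (Fin n))}

lemma volume_diff_isometry_le_of_reflection {B : ENNReal} (hK : MeasurableSet K)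
    (h : ∀ u : EuclideanSpace ℝ (Fin n), ‖u‖ = 1 →
      volume (K \ (ℝ ∙ u)ᗮ.reflection ⁻¹' K) ≤ B)
    (g : EuclideanSpace ℝ (Fin n) ≃ₗᵢ[ℝ] EuclideanSpace ℝ (Fin n)) :
    volume (K \ g ⁻¹' K) ≤ n * B := by
  have h' : ∀ v : EuclideanSpace ℝ (Fin n), volume (K \ (ℝ ∙ v)ᗮ.reflection ⁻¹' K) ≤ B := by
    intro v
    rcases eq_or_ne v 0 with rfl | hv
    · have : K \ (ℝ ∙ (0 : EuclideanSpace ℝ (Fin n)))ᗮ.reflection ⁻¹' K = ∅ := by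
        refine Set.eq_empty_of_forall_notMem fun x hx => hx.2 ?_
        rw [Set.mem_preimage, Submodule.reflection_orthogonal_apply,
          Submodule.reflection_singleton_apply]
        simpa using hx.1
      rw [this, measure_empty]
      exact zero_le
    · have hn : ‖‖v‖⁻¹ • v‖ = 1 := norm_smul_inv_norm (𝕜 := ℝ) hv
      have hs : (ℝ ∙ (‖v‖⁻¹ • v)) = (ℝ ∙ v) :=
        Submodule.span_singleton_smul_eq (IsUnit.mk0 _ (by simpa using hv)) v
      have := h _ hn
      simp only [hs] at this
      exact this
  have hl : ∀ l : List (EuclideanSpace ℝ (Fin n)),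
      volume (K \ (l.map fun v => (ℝ ∙ v)ᗮ.reflection).prod ⁻¹' K) ≤ l.length * B := by
    intro l
    induction l with
    | nil => simp
    | cons v l ih =>
      set g := (l.map fun v => (ℝ ∙ v)ᗮ.reflection).prod with hg
      have hsub : K \ ((v :: l).map fun v => (ℝ ∙ v)ᗮ.reflection).prod ⁻¹' K ⊆
          (K \ g ⁻¹' K) ∪ g ⁻¹' (K \ (ℝ ∙ v)ᗮ.reflection ⁻¹' K) := by
        rintro x ⟨hx, hx'⟩
        rw [List.map_cons, List.prod_cons] at hx'
        by_cases hgx : g x ∈ K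
        · exact Or.inr ⟨hgx, hx'⟩
        · exact Or.inl ⟨hx, hgx⟩
      refine (measure_mono hsub).trans ((measure_union_le _ _).trans ?_)
      rw [g.measurePreserving.measure_preimage (hK.diff
        ((ℝ ∙ v)ᗮ.reflection.continuous.measurable hK)).nullMeasurableSet]
      rw [List.length_cons, Nat.cast_add, add_mul]
      simpa using add_le_add ih (h' v)
  obtain ⟨l, hlen, rfl⟩ := g.reflections_generate_dim
  refine (hl l).trans ?_
  gcongr
  simpa using hlen

end Isometries

section Iteration

variable {n : ℕ} {u : EuclideanSpace ℝ (Fin n)} {K : Set (EuclideanSpace ℝ (Fin n))}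

/-- The second moment of `K` about the origin. -/
noncomputable def secondMoment {n : ℕ} (K : Set (EuclideanSpace ℝ (Fin n))) : ℝ :=
  (∫⁻ x in K, ENNReal.ofReal (‖x‖ ^ 2)).toReal

lemma lintegral_norm_sq_le {R : ℝ} (h : K ⊆ closedBall 0 R) :
    ∫⁻ x in K, ENNReal.ofReal (‖x‖ ^ 2) ≤ ENNReal.ofReal (R ^ 2) * volume K := by
  rw [← setLIntegral_const]
  refine setLIntegral_mono measurable_const fun x hx => ENNReal.ofReal_le_ofReal ?_
  have := h hx
  rw [mem_closedBall_zero_iff] at this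
  gcongr

lemma lintegral_norm_sq_ne_top (hK : IsCompact K) :
    ∫⁻ x in K, ENNReal.ofReal (‖x‖ ^ 2) ≠ ⊤ := by
  obtain ⟨R, hR⟩ := hK.isBounded.subset_closedBall 0
  exact ne_top_of_le_ne_top (ENNReal.mul_ne_top ENNReal.ofReal_ne_top hK.measure_ne_top)
    (lintegral_norm_sq_le hR)

lemma secondMoment_le (hK : IsCompact K) {R : ℝ} (h : K ⊆ closedBall 0 R) :
    secondMoment K ≤ R ^ 2 * (volume K).toReal := by
  have := ENNReal.toReal_mono (ENNReal.mul_ne_top ENNReal.ofReal_ne_top hK.measure_ne_top)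
    (lintegral_norm_sq_le h)
  rwa [ENNReal.toReal_mul, ENNReal.toReal_ofReal (sq_nonneg R)] at this

lemma secondMoment_steinerSymmetral_add_le (hn : 0 < n) (hu : ‖u‖ = 1) (hK : IsCompact K)
    (hc : Convex ℝ K) {ρ κ : ℝ} (hρ : 0 < ρ) (hball : closedBall 0 ρ ⊆ K) (hκ : 0 < κ) (hκ1 : κ < 1)
    (h : ENNReal.ofReal κ * volume K ≤ volume (K \ (ℝ ∙ u)ᗮ.reflection ⁻¹' K)) :
    secondMoment (steinerSymmetral u K) + κ ^ 4 * ρ ^ 2 * (volume K).toReal / (32 * n ^ 2) ≤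
      secondMoment K := by
  have hn1 : (1 : ℝ) ≤ n := by exact_mod_cast hn
  have hS := isCompact_steinerSymmetral hu hK hc
  set t := κ / (4 * n) with ht
  have ht0 : 0 < t := by positivity
  have ht1 : t < 1 := by rw [ht, div_lt_one (by positivity)]; linarith
  have hη : 0 < κ / 4 := by positivity
  have h0 : (0 : EuclideanSpace ℝ (Fin n)) ∈ K := hball (by simp [hρ.le])
  have h1 := reflection_asymmetry_le hu hK hc hρ hball ht0 ht1 hη
  set w := 1 / (κ / 4 * (2 * t * ρ) ^ 2) with hw
  have hw0 : 0 < w := by positivity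
  have hint : ∀ A : Set (EuclideanSpace ℝ (Fin n)), ∫⁻ x in A, ENNReal.ofReal (w * ‖x‖ ^ 2) =
      ENNReal.ofReal w * ∫⁻ x in A, ENNReal.ofReal (‖x‖ ^ 2) := by
    intro A
    rw [← lintegral_const_mul _ (by fun_prop)]
    simp_rw [ENNReal.ofReal_mul hw0.le]
  rw [hint, hint] at h1
  have hKf := hK.measure_ne_top (μ := volume)
  have hIK := lintegral_norm_sq_ne_top hK
  have hIS := lintegral_norm_sq_ne_top hS
  have h2 := (add_le_add_left h _).trans (h1.trans (add_le_add_left (add_le_add_left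
    (volume_diff_smul_le hK hc h0 ht0.le ht1.le) _) _))
  have h3 := ENNReal.toReal_mono (by finiteness) h2
  rw [ENNReal.toReal_add, ENNReal.toReal_add, ENNReal.toReal_add] at h3
  · simp only [ENNReal.toReal_mul, ENNReal.toReal_ofReal hκ.le, ENNReal.toReal_ofReal hw0.le,
      ENNReal.toReal_ofReal hη.le, ENNReal.toReal_ofReal (show 0 ≤ (n : ℝ) * t by positivity)] at h3
    have h4 : κ / 2 * (volume K).toReal + w * secondMoment (steinerSymmetral u K) ≤
        w * secondMoment K := by
      have : (n : ℝ) * t = κ / 4 := by rw [ht]; field_simp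
      rw [this] at h3
      unfold secondMoment
      linarith
    have h5 : κ ^ 4 * ρ ^ 2 * (volume K).toReal / (32 * n ^ 2) * w = κ / 2 * (volume K).toReal := by
      rw [hw, ht]
      field_simp
      ring
    rw [← h5] at h4
    refine le_of_mul_le_mul_left ?_ hw0
    linarith
  all_goals finiteness

lemma volume_symmDiff_closedBall_le_of_reflection (hn : 0 < n) (hK : IsCompact K)
    (hc : Convex ℝ K) (h0 : (0 : EuclideanSpace ℝ (Fin n)) ∈ K)
    (hvol : volume K = volume (closedBall (0 : EuclideanSpace ℝ (Fin n)) 1)) {B : ENNReal}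
    (h : ∀ u : EuclideanSpace ℝ (Fin n), ‖u‖ = 1 →
      volume (K \ (ℝ ∙ u)ᗮ.reflection ⁻¹' K) ≤ B) :
    volume (symmDiff K (closedBall (0 : EuclideanSpace ℝ (Fin n)) 1)) ≤ 4 * n * B := by
  have : NeZero n := ⟨hn.ne'⟩
  have h1 : volume (K \ closedBall 0 1) ≤ 2 * (n * B) :=
    measure_diff_closedBall_le (fun g => g.measurePreserving) hK h0
      (fun x hx t ht0 ht1 => (hc.starConvex h0).smul_mem hx ht0 ht1) hvol
      (volume_diff_isometry_le_of_reflection hK.measurableSet h)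
  have h2 := measure_diff_eq_of_measure_eq hK.measurableSet measurableSet_closedBall
    hK.measure_ne_top hvol
  refine (measure_union_le _ _).trans ?_
  rw [← h2]
  refine (add_le_add h1 h1).trans (le_of_eq ?_)
  ring

/-- Greedy symmetrization: as long as the body is far from the ball, some symmetrization
decreases the second moment by a definite amount. -/
lemma exists_list_symmDiff_lt (hn : 0 < n) {ε ρ : ℝ} (hε : 0 < ε) (hε1 : ε < 1) (hρ : 0 < ρ)
    (M : ℕ) : ∀ K : Set (EuclideanSpace ℝ (Fin n)), IsCompact K → Convex ℝ K →
      volume K = volume (closedBall (0 : EuclideanSpace ℝ (Fin n)) 1) → closedBall 0 ρ ⊆ K →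
      secondMoment K ≤ M * ((ε / (8 * n)) ^ 4 * ρ ^ 2 *
        (volume (closedBall (0 : EuclideanSpace ℝ (Fin n)) 1)).toReal / (32 * n ^ 2)) →
      ∃ l : List (EuclideanSpace ℝ (Fin n)), l.length ≤ M ∧ (∀ u ∈ l, ‖u‖ = 1) ∧
        (volume (symmDiff (l.foldl (fun S v => steinerSymmetral v S) K)
          (closedBall (0 : EuclideanSpace ℝ (Fin n)) 1))).toReal <
        ε * (volume (closedBall (0 : EuclideanSpace ℝ (Fin n)) 1)).toReal := by
  set V := (volume (closedBall (0 : EuclideanSpace ℝ (Fin n)) 1)).toReal with hV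
  have hVtop : volume (closedBall (0 : EuclideanSpace ℝ (Fin n)) 1) ≠ ⊤ :=
    measure_closedBall_lt_top.ne
  have hV0 : 0 < V := ENNReal.toReal_pos (measure_closedBall_pos _ _ one_pos).ne' hVtop
  have hn1 : (1 : ℝ) ≤ n := by exact_mod_cast hn
  set κ := ε / (8 * n) with hκ
  have hκ0 : 0 < κ := by positivity
  have hκ1 : κ < 1 := by rw [hκ, div_lt_one (by positivity)]; linarith
  have hd : 0 < κ ^ 4 * ρ ^ 2 * V / (32 * n ^ 2) := by positivity
  have hstep : ∀ K : Set (EuclideanSpace ℝ (Fin n)), IsCompact K → Convex ℝ K →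
      volume K = volume (closedBall (0 : EuclideanSpace ℝ (Fin n)) 1) → closedBall 0 ρ ⊆ K →
      ¬ (volume (symmDiff K (closedBall (0 : EuclideanSpace ℝ (Fin n)) 1))).toReal < ε * V →
      ∃ u : EuclideanSpace ℝ (Fin n), ‖u‖ = 1 ∧
        secondMoment (steinerSymmetral u K) + κ ^ 4 * ρ ^ 2 * V / (32 * n ^ 2) ≤
          secondMoment K := by
    intro K hK hc hvol hball hfar
    by_contra! hcon
    refine hfar ?_
    have hle := volume_symmDiff_closedBall_le_of_reflection hn hK hc (hball (by simp [hρ.le])) hvol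
      (B := ENNReal.ofReal κ * volume K) fun u hu => by
        by_contra! hlt
        have := secondMoment_steinerSymmetral_add_le hn hu hK hc hρ hball hκ0 hκ1 hlt.le
        rw [hvol] at this
        exact (hcon u hu).not_ge this
    rw [hvol] at hle
    have hle' := ENNReal.toReal_mono (by finiteness) hle
    simp only [ENNReal.toReal_mul, ENNReal.toReal_ofReal hκ0.le, ENNReal.toReal_ofNat,
      ENNReal.toReal_natCast, ← hV] at hle'
    have : 4 * (n : ℝ) * (κ * V) = ε / 2 * V := by rw [hκ]; field_simp; ring
    rw [this] at hle'
    refine hle'.trans_lt ?_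
    gcongr
    linarith
  induction M with
  | zero =>
    intro K hK hc hvol hball hI
    refine ⟨[], le_rfl, by simp, ?_⟩
    by_contra hfar
    obtain ⟨u, hu, h⟩ := hstep K hK hc hvol hball hfar
    have : 0 ≤ secondMoment (steinerSymmetral u K) := ENNReal.toReal_nonneg
    simp only [CharP.cast_eq_zero, zero_mul] at hI
    linarith
  | succ M ih =>
    intro K hK hc hvol hball hI
    by_cases hfar :
        (volume (symmDiff K (closedBall (0 : EuclideanSpace ℝ (Fin n)) 1))).toReal < ε * V
    · exact ⟨[], by simp, by simp, hfar⟩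
    obtain ⟨u, hu, h⟩ := hstep K hK hc hvol hball hfar
    obtain ⟨l, hl, hlu, hlt⟩ := ih (steinerSymmetral u K) (isCompact_steinerSymmetral hu hK hc)
      (convex_steinerSymmetral hu hK hc) ((volume_steinerSymmetral hu hK hc).trans hvol)
      (closedBall_subset_steinerSymmetral hu hK hc hball) (by
        push_cast at hI
        linarith)
    exact ⟨u :: l, by simpa using hl, by simpa [hu] using hlu, hlt⟩

end Iteration

section Rounding

variable {n : ℕ} {u : EuclideanSpace ℝ (Fin n)} {K : Set (EuclideanSpace ℝ (Fin n))}

lemma foldl_steinerSymmetral_invariants (l : List (EuclideanSpace ℝ (Fin n)))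
    (hl : ∀ u ∈ l, ‖u‖ = 1) : ∀ K : Set (EuclideanSpace ℝ (Fin n)), IsCompact K → Convex ℝ K →
      IsCompact (l.foldl (fun S v => steinerSymmetral v S) K) ∧
      Convex ℝ (l.foldl (fun S v => steinerSymmetral v S) K) ∧
      volume (l.foldl (fun S v => steinerSymmetral v S) K) = volume K := by
  induction l with
  | nil => exact fun K hK hc => ⟨hK, hc, rfl⟩
  | cons u l ih =>
    intro K hK hc
    have hu := hl u (by simp)
    obtain ⟨h1, h2, h3⟩ := ih (fun v hv => hl v (by simp [hv])) _
      (isCompact_steinerSymmetral hu hK hc) (convex_steinerSymmetral hu hK hc)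
    exact ⟨h1, h2, h3.trans (volume_steinerSymmetral hu hK hc)⟩

lemma reflection_mem_foldl_of_orthogonal {v : EuclideanSpace ℝ (Fin n)} (hv : ‖v‖ = 1)
    (l : List (EuclideanSpace ℝ (Fin n))) (hl : ∀ u ∈ l, ‖u‖ = 1 ∧ ⟪u, v⟫ = 0) :
    ∀ K : Set (EuclideanSpace ℝ (Fin n)), IsCompact K → Convex ℝ K →
      (∀ x ∈ K, (ℝ ∙ v)ᗮ.reflection x ∈ K) →
      ∀ x ∈ l.foldl (fun S v => steinerSymmetral v S) K,
        (ℝ ∙ v)ᗮ.reflection x ∈ l.foldl (fun S v => steinerSymmetral v S) K := by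
  induction l with
  | nil => exact fun K _ _ h => h
  | cons u l ih =>
    intro K hK hc h
    obtain ⟨hu, huv⟩ := hl u (by simp)
    exact ih (fun w hw => hl w (by simp [hw])) _ (isCompact_steinerSymmetral hu hK hc)
      (convex_steinerSymmetral hu hK hc)
      fun x hx => reflection_mem_steinerSymmetral_of_orthogonal hu hK hc hv huv h hx

lemma reflection_mem_foldl (l : List (EuclideanSpace ℝ (Fin n))) (hl : ∀ u ∈ l, ‖u‖ = 1)
    (hp : l.Pairwise fun u v => ⟪u, v⟫ = 0) :
    ∀ K : Set (EuclideanSpace ℝ (Fin n)), IsCompact K → Convex ℝ K → ∀ v ∈ l,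
      ∀ x ∈ l.foldl (fun S v => steinerSymmetral v S) K,
        (ℝ ∙ v)ᗮ.reflection x ∈ l.foldl (fun S v => steinerSymmetral v S) K := by
  induction l with
  | nil => simp
  | cons u l ih =>
    intro K hK hc v hv
    have hu := hl u (by simp)
    have hl' : ∀ u ∈ l, ‖u‖ = 1 := fun w hw => hl w (by simp [hw])
    rw [List.pairwise_cons] at hp
    rcases List.mem_cons.1 hv with rfl | hv
    · exact reflection_mem_foldl_of_orthogonal hu l
        (fun w hw => ⟨hl' w hw, by rw [real_inner_comm]; exact hp.1 w hw⟩) _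
        (isCompact_steinerSymmetral hu hK hc) (convex_steinerSymmetral hu hK hc)
        fun x hx => reflection_mem_steinerSymmetral hu hK hc hx
    · exact ih hl' hp.2 _ (isCompact_steinerSymmetral hu hK hc)
        (convex_steinerSymmetral hu hK hc) v hv

/-- The semi-axes of the smallest coordinate box containing an unconditional body lie in it. -/
lemma exists_semiaxes (hK : IsCompact K) (hc : Convex ℝ K) (hvol : volume K ≠ 0)
    (hsym : ∀ i : Fin n, ∀ x ∈ K, x - (2 * x i) • EuclideanSpace.single i (1 : ℝ) ∈ K) :
    ∃ a : Fin n → ℝ, (∀ i, 0 < a i) ∧ (∀ x ∈ K, ∀ i, |x i| ≤ a i) ∧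
      ∀ i, a i • EuclideanSpace.single i (1 : ℝ) ∈ K := by
  have hne : K.Nonempty := by
    by_contra h
    exact hvol (by rw [Set.not_nonempty_iff_eq_empty.1 h, measure_empty])
  have hzero : ∀ p ∈ K, ∀ s : Finset (Fin n), ∃ q ∈ K, ∀ j, q j = if j ∈ s then 0 else p j := by
    intro p hp s
    induction s using Finset.induction_on with
    | empty => exact ⟨p, hp, by simp⟩
    | insert j s hj ih =>
      obtain ⟨q, hq, hqs⟩ := ih
      refine ⟨q - q j • EuclideanSpace.single j (1 : ℝ), ?_, fun k => ?_⟩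
      · have := hc hq (hsym j q hq) (a := 1 / 2) (b := 1 / 2) (by norm_num) (by norm_num)
          (by norm_num)
        convert! this using 1
        module
      · by_cases hk : k = j
        · subst hk; simp
        · have := hqs k
          simp [hk, this]
  have hmax : ∀ i : Fin n, ∃ p ∈ K, ∀ x ∈ K, |x i| ≤ |p i| := fun i =>
    hK.exists_isMaxOn hne (f := fun x : EuclideanSpace ℝ (Fin n) => |x i|) (by fun_prop)
  choose p hpK hp using hmax
  refine ⟨fun i => |p i i|, fun i => ?_, fun x hx i => hp i x hx, fun i => ?_⟩
  · refine lt_of_le_of_ne (abs_nonneg _) fun h0 => hvol ?_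
    have hsub : K ⊆
        (LinearMap.ker (EuclideanSpace.proj (𝕜 := ℝ) i : EuclideanSpace ℝ (Fin n) →L[ℝ] ℝ).toLinearMap :
        Submodule ℝ (EuclideanSpace ℝ (Fin n))) := by
      intro x hx
      have := (hp i x hx).trans_eq h0.symm
      simpa using this
    refine measure_mono_null hsub (Measure.addHaar_submodule _ _ fun htop => ?_)
    have : EuclideanSpace.single i (1 : ℝ) ∈ (⊤ : Submodule ℝ (EuclideanSpace ℝ (Fin n))) := trivial
    rw [← htop] at this
    simp at this
  · obtain ⟨q, hq, hqs⟩ := hzero (p i) (hpK i) (Finset.univ.erase i)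
    have hqe : q = p i i • EuclideanSpace.single i (1 : ℝ) := by
      ext k
      rw [hqs]
      by_cases hk : k = i
      · subst hk; simp
      · simp [hk]
    rcases abs_cases (p i i) with ⟨h, -⟩ | ⟨h, -⟩
    · simp only [h]; rwa [← hqe]
    · have h2 := hsym i q hq
      simp only [h]
      convert! h2 using 1
      rw [hqe]
      simp
      module

/-- Effect of a Steiner symmetrization on bodies sandwiched between sublevel sets of a quadratic
form, when the form splits off a square in direction `u`. -/
lemma sublevel_steinerSymmetral (hu : ‖u‖ = 1) (hK : IsCompact K) (hc : Convex ℝ K) {r m M : ℝ}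
    (hr : 0 < r) {f T : EuclideanSpace ℝ (Fin n) → ℝ} (hf : ∀ y (s : ℝ), f (y + s • u) = f y)
    (hT : ∀ y (s : ℝ), T (y + s • u) = T y)
    (hin : ∀ x, (⟪u, x⟫ / r + f x) ^ 2 + T x ≤ m → x ∈ K)
    (hout : ∀ x ∈ K, (⟪u, x⟫ / r + f x) ^ 2 + T x ≤ M) :
    (∀ x, (⟪u, x⟫ / r) ^ 2 + T x ≤ m → x ∈ steinerSymmetral u K) ∧
      ∀ x ∈ steinerSymmetral u K, (⟪u, x⟫ / r) ^ 2 + T x ≤ M := by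
  have hline : ∀ y (s : ℝ), ⟪u, y⟫ = 0 → ⟪u, y + s • u⟫ = s := fun y s hy => by
    rw [inner_add_right, inner_smul_right, hy, inner_self_of_norm_one hu]; ring
  constructor
  · intro z hz
    set y := z - ⟪u, z⟫ • u with hy
    have hzy : z = y + ⟪u, z⟫ • u := by rw [hy]; module
    have huy : ⟪u, y⟫ = 0 := by
      rw [hy, inner_sub_right, inner_smul_right, inner_self_of_norm_one hu]; ring
    rw [hzy, hT, hline _ _ huy] at hz
    rw [mem_steinerSymmetral_iff hu hK hc]
    refine ⟨y, ⟪u, z⟫ - r * f y, -⟪u, z⟫ - r * f y, huy, hin _ ?_, hin _ ?_, ?_⟩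
    · rw [hline _ _ huy, hf, hT]
      refine le_of_eq_of_le ?_ hz
      field_simp
      ring
    · rw [hline _ _ huy, hf, hT]
      refine le_of_eq_of_le ?_ hz
      field_simp
      ring
    · conv_lhs => rw [hzy]
      congr 2
      ring
  · intro z hz
    rw [mem_steinerSymmetral_iff hu hK hc] at hz
    obtain ⟨y, s, t, huy, hs, ht, rfl⟩ := hz
    have h1 := hout _ hs
    have h2 := hout _ ht
    rw [hline _ _ huy, hf, hT] at h1 h2
    rw [hline _ _ huy, hT]
    have : (s - t) / 2 / r = ((s / r + f y) - (t / r + f y)) / 2 := by ring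
    rw [this]
    nlinarith [sq_nonneg ((s / r + f y) + (t / r + f y))]

end Rounding

section Ellipsoids

variable {n : ℕ} {K : Set (EuclideanSpace ℝ (Fin n))}

lemma exists_lt_lt_of_prod_eq_pow {a : Fin n → ℝ} {r : ℝ} (ha : ∀ i, 0 < a i) (hr : 0 < r)
    (hprod : ∏ i, a i = r ^ n) (hne : ∃ i, a i ≠ r) : ∃ i j, r < a i ∧ a j < r := by
  obtain ⟨k, hk⟩ := hne
  have hconst : ∏ _i : Fin n, r = r ^ n := by simp
  have h1 : ∃ i, r < a i := by
    by_contra! h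
    refine (Finset.prod_lt_prod (f := a) (g := fun _ => r) (fun i _ => ha i) (fun i _ => h i)
      ⟨k, Finset.mem_univ k, lt_of_le_of_ne (h k) hk⟩).ne ?_
    rw [hprod, hconst]
  have h2 : ∃ j, a j < r := by
    by_contra! h
    refine (Finset.prod_lt_prod (f := fun _ => r) (g := a) (fun _ _ => hr) (fun i _ => h i)
      ⟨k, Finset.mem_univ k, lt_of_le_of_ne (h k) hk.symm⟩).ne ?_
    rw [hprod, hconst]
  exact ⟨h1.choose, h2.choose, h1.choose_spec, h2.choose_spec⟩

lemma Orthonormal.sum_sq_inner {v : Fin n → EuclideanSpace ℝ (Fin n)} (hv : Orthonormal ℝ v)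
    (x : EuclideanSpace ℝ (Fin n)) : ∑ i, ⟪v i, x⟫ ^ 2 = ‖x‖ ^ 2 := by
  obtain ⟨b, hb⟩ := Orthonormal.exists_orthonormalBasis_extension_of_card_eq (𝕜 := ℝ)
    (E := EuclideanSpace ℝ (Fin n)) (ι := Fin n) (by simp) (s := Set.univ) (v := v)
    (hv.comp _ Subtype.val_injective)
  rw [← b.sum_sq_norm_inner_right x]
  simp [hb]

/-- Rotating two members of an orthonormal family in their common plane. -/
lemma Orthonormal.rotate {v : Fin n → EuclideanSpace ℝ (Fin n)} (hv : Orthonormal ℝ v)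
    {i j : Fin n} (hij : i ≠ j) {c s : ℝ} (hcs : c ^ 2 + s ^ 2 = 1) :
    Orthonormal ℝ (Function.update (Function.update v j (-s • v i + c • v j)) i
      (c • v i + s • v j)) := by
  rw [orthonormal_iff_ite] at hv ⊢
  have hji := hij.symm
  have huu : ⟪c • v i + s • v j, c • v i + s • v j⟫ = 1 := by
    simp only [inner_add_left, inner_add_right, real_inner_smul_left, real_inner_smul_right, hv,
      hij, hji, if_true, if_false]
    linear_combination hcs
  have hww : ⟪-s • v i + c • v j, -s • v i + c • v j⟫ = 1 := by
    simp only [inner_add_left, inner_add_right, real_inner_smul_left, real_inner_smul_right, hv,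
      hij, hji, if_true, if_false]
    linear_combination hcs
  have huw : ⟪c • v i + s • v j, -s • v i + c • v j⟫ = 0 := by
    simp only [inner_add_left, inner_add_right, real_inner_smul_left, real_inner_smul_right, hv,
      hij, hji, if_true, if_false]
    ring
  have hother : ∀ k, k ≠ i → k ≠ j → ∀ p q : ℝ, ⟪p • v i + q • v j, v k⟫ = 0 := by
    intro k hki hkj p q
    simp [inner_add_left, real_inner_smul_left, hv, hki.symm, hkj.symm]
  have hu := fun k hki hkj => hother k hki hkj c s
  have hw := fun k hki hkj => hother k hki hkj (-s) c
  have hwu := (real_inner_comm _ _).trans huw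
  have hu' := fun k hki hkj => (real_inner_comm _ _).trans (hu k hki hkj)
  have hw' := fun k hki hkj => (real_inner_comm _ _).trans (hw k hki hkj)
  clear hother
  generalize c • v i + s • v j = U at *
  generalize -s • v i + c • v j = W at *
  intro k l
  simp only [Function.update_apply]
  by_cases hki : k = i
  · by_cases hli : l = i
    · simpa [hki, hli] using huu
    by_cases hlj : l = j
    · simpa [hki, hlj, hij, hji] using huw
    · simpa [hki, hli, hlj, Ne.symm hli] using hu l hli hlj
  by_cases hkj : k = j
  · by_cases hli : l = i
    · simpa [hkj, hli, hij, hji] using hwu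
    by_cases hlj : l = j
    · simpa [hkj, hlj, hji] using hww
    · simpa [hkj, hli, hlj, hji, Ne.symm hlj] using hw l hli hlj
  by_cases hli : l = i
  · simpa [hli, hki, hkj] using hu' k hki hkj
  by_cases hlj : l = j
  · simpa [hlj, hji, hki, hkj] using hw' k hki hkj
  · simpa [hki, hli, hkj, hlj] using hv k l

lemma sum_eq_add_add_sum_erase {M : Type*} [AddCommMonoid M] {i j : Fin n} (hij : i ≠ j)
    (f : Fin n → M) : ∑ k, f k = f i + (f j + ∑ k ∈ (Finset.univ.erase i).erase j, f k) := by
  rw [← Finset.add_sum_erase _ f (Finset.mem_univ i), ← Finset.add_sum_erase _ f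
    (Finset.mem_erase.2 ⟨hij.symm, Finset.mem_univ j⟩)]

lemma prod_eq_mul_mul_prod_erase {M : Type*} [CommMonoid M] {i j : Fin n} (hij : i ≠ j)
    (f : Fin n → M) : ∏ k, f k = f i * (f j * ∏ k ∈ (Finset.univ.erase i).erase j, f k) := by
  rw [← Finset.mul_prod_erase _ f (Finset.mem_univ i), ← Finset.mul_prod_erase _ f
    (Finset.mem_erase.2 ⟨hij.symm, Finset.mem_univ j⟩)]

lemma quadratic_rotation_identity {a b r c s : ℝ} (ha : a ≠ 0) (hb : b ≠ 0) (hr : r ≠ 0)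
    (hcs : c ^ 2 + s ^ 2 = 1) (h : (c / a) ^ 2 + (s / b) ^ 2 = (1 / r) ^ 2) (p q : ℝ) :
    (p / a) ^ 2 + (q / b) ^ 2 =
      ((c * p + s * q) / r + r * c * s * (1 / b ^ 2 - 1 / a ^ 2) * (-s * p + c * q)) ^ 2 +
        ((-s * p + c * q) / (a * b / r)) ^ 2 := by
  obtain ⟨A, rfl⟩ : ∃ A, a = A⁻¹ := ⟨a⁻¹, by simp⟩
  obtain ⟨B, rfl⟩ : ∃ B, b = B⁻¹ := ⟨b⁻¹, by simp⟩
  obtain ⟨R, rfl⟩ : ∃ R, r = R⁻¹ := ⟨r⁻¹, by simp⟩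
  simp only [div_inv_eq_mul, one_mul, inv_pow] at h ⊢
  have hR : R ≠ 0 := by simpa using hr
  set α := c * p + s * q with hα
  set τ := -s * p + c * q with hτ
  have hp : p = c * α - s * τ := by rw [hα, hτ]; linear_combination (-p) * hcs
  have hq : q = s * α + c * τ := by rw [hα, hτ]; linear_combination (-q) * hcs
  have hdet : (c * s * (B ^ 2 - A ^ 2)) ^ 2 + (A * B) ^ 2 =
      ((s * A) ^ 2 + (c * B) ^ 2) * R ^ 2 := by
    rw [← h]
    linear_combination (-(A * B) ^ 2 * (c ^ 2 + s ^ 2 + 1)) * hcs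
  have e1 : τ / (A⁻¹ * B⁻¹ * R) = τ * (A * B) / R := by
    rw [← mul_inv, div_mul_eq_div_div, div_inv_eq_mul]
  rw [e1, hp, hq]
  clear_value α τ
  have e2 : (α * R + R⁻¹ * c * s * (B ^ 2 - A ^ 2) * τ) ^ 2 + (τ * (A * B) / R) ^ 2 =
      α ^ 2 * R ^ 2 + 2 * α * τ * (c * s * (B ^ 2 - A ^ 2)) +
        τ ^ 2 * ((c * s * (B ^ 2 - A ^ 2)) ^ 2 + (A * B) ^ 2) / R ^ 2 := by
    field_simp
    ring
  rw [e2, hdet, ← mul_assoc (τ ^ 2), mul_div_cancel_right₀ _ (pow_ne_zero 2 hR)]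
  linear_combination α ^ 2 * h

lemma exists_rotation_coeffs {a b r : ℝ} (hb : 0 < b) (hbr : b < r) (hra : r < a) :
    ∃ c s : ℝ, c ^ 2 + s ^ 2 = 1 ∧ (c / a) ^ 2 + (s / b) ^ 2 = (1 / r) ^ 2 := by
  have hr : 0 < r := hb.trans hbr
  have ha : 0 < a := hr.trans hra
  have h1 : r ^ 2 < a ^ 2 := by gcongr
  have h2 : b ^ 2 < r ^ 2 := by gcongr
  have h3 : 0 < a ^ 2 - b ^ 2 := by linarith
  refine ⟨√(a ^ 2 * (r ^ 2 - b ^ 2) / (r ^ 2 * (a ^ 2 - b ^ 2))),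
    √(b ^ 2 * (a ^ 2 - r ^ 2) / (r ^ 2 * (a ^ 2 - b ^ 2))), ?_, ?_⟩
  · rw [Real.sq_sqrt (div_nonneg (mul_nonneg (by positivity) (by linarith)) (by positivity)),
      Real.sq_sqrt (div_nonneg (mul_nonneg (by positivity) (by linarith)) (by positivity))]
    field_simp
    ring
  · rw [div_pow, div_pow,
      Real.sq_sqrt (div_nonneg (mul_nonneg (by positivity) (by linarith)) (by positivity)),
      Real.sq_sqrt (div_nonneg (mul_nonneg (by positivity) (by linarith)) (by positivity))]
    field_simp
    ring

/-- Successive symmetrizations rounding a body sandwiched between two homothetic ellipsoids. -/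
lemma exists_list_ellipsoid_to_ball {r m M : ℝ} (hr : 0 < r) (k : ℕ) :
    ∀ (v : Fin n → EuclideanSpace ℝ (Fin n)) (a : Fin n → ℝ)
      (K : Set (EuclideanSpace ℝ (Fin n))), Orthonormal ℝ v → (∀ i, 0 < a i) →
      ∏ i, a i = r ^ n → (Finset.univ.filter fun i => a i ≠ r).card ≤ k → IsCompact K →
      Convex ℝ K → (∀ x, ∑ i, (⟪v i, x⟫ / a i) ^ 2 ≤ m → x ∈ K) →
      (∀ x ∈ K, ∑ i, (⟪v i, x⟫ / a i) ^ 2 ≤ M) →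
      ∃ l : List (EuclideanSpace ℝ (Fin n)), l.length ≤ k ∧ (∀ u ∈ l, ‖u‖ = 1) ∧
        (∀ x, (‖x‖ / r) ^ 2 ≤ m → x ∈ l.foldl (fun S v => steinerSymmetral v S) K) ∧
        ∀ x ∈ l.foldl (fun S v => steinerSymmetral v S) K, (‖x‖ / r) ^ 2 ≤ M := by
  have hround : ∀ (v : Fin n → EuclideanSpace ℝ (Fin n)) (a : Fin n → ℝ), Orthonormal ℝ v →
      (∀ i, a i = r) → ∀ x, ∑ i, (⟪v i, x⟫ / a i) ^ 2 = (‖x‖ / r) ^ 2 := by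
    intro v a hv ha x
    simp_rw [ha, div_pow]
    rw [← Finset.sum_div, hv.sum_sq_inner]
  induction k with
  | zero =>
    intro v a K hv ha hprod hcard hK hc hin hout
    have har : ∀ i, a i = r := by simpa [Finset.filter_eq_empty_iff] using hcard
    simp only [hround v a hv har] at hin hout
    exact ⟨[], le_rfl, by simp, hin, hout⟩
  | succ k ih =>
    intro v a K hv ha hprod hcard hK hc hin hout
    by_cases har : ∀ i, a i = r
    · simp only [hround v a hv har] at hin hout
      exact ⟨[], by simp, by simp, hin, hout⟩
    push Not at har
    obtain ⟨i, j, hi, hj⟩ := exists_lt_lt_of_prod_eq_pow ha hr hprod har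
    have hij : i ≠ j := by rintro rfl; exact lt_asymm hi hj
    obtain ⟨c, s, hcs, hac⟩ := exists_rotation_coeffs (ha j) hj hi
    have hai := ha i
    have haj := ha j
    set u := c • v i + s • v j with hu
    set w := -s • v i + c • v j with hw
    set v' := Function.update (Function.update v j w) i u with hv'
    set a' := Function.update (Function.update a j (a i * a j / r)) i r with ha'
    have hvo : Orthonormal ℝ v' := hv.rotate hij hcs
    have hvi : v' i = u := by simp [hv']
    have hvj : v' j = w := by simp [hv', hij.symm]
    have hai' : a' i = r := by simp [ha']
    have haj' : a' j = a i * a j / r := by simp [ha', hij.symm]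
    have hvk : ∀ k ∈ (Finset.univ.erase i).erase j, v' k = v k := fun k hk => by
      simp only [Finset.mem_erase] at hk
      simp [hv', hk.1, hk.2.1]
    have hak : ∀ k ∈ (Finset.univ.erase i).erase j, a' k = a k := fun k hk => by
      simp only [Finset.mem_erase] at hk
      simp [ha', hk.1, hk.2.1]
    have hun : ‖u‖ = 1 := hvi ▸ hvo.norm_eq_one i
    have huk : ∀ k, k ≠ i → ⟪v' k, u⟫ = 0 := fun k hk => hvi ▸ hvo.inner_eq_zero hk
    let T : EuclideanSpace ℝ (Fin n) → ℝ := fun x =>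
      (⟪w, x⟫ / a' j) ^ 2 + ∑ k ∈ (Finset.univ.erase i).erase j, (⟪v k, x⟫ / a k) ^ 2
    let f : EuclideanSpace ℝ (Fin n) → ℝ := fun x =>
      r * c * s * (1 / a j ^ 2 - 1 / a i ^ 2) * ⟪w, x⟫
    have hwu : ⟪w, u⟫ = 0 := hvj ▸ huk j hij.symm
    have hf : ∀ y (t : ℝ), f (y + t • u) = f y := fun y t => by
      simp only [f, inner_add_right, inner_smul_right, hwu]
      ring
    have hT : ∀ y (t : ℝ), T (y + t • u) = T y := fun y t => by
      simp only [T, inner_add_right, inner_smul_right, hwu]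
      congr 1
      · ring
      · refine Finset.sum_congr rfl fun k hk => ?_
        rw [← hvk k hk, huk k (Finset.ne_of_mem_erase (Finset.mem_of_mem_erase hk))]
        ring
    have hQ : ∀ x, ∑ k, (⟪v k, x⟫ / a k) ^ 2 = (⟪u, x⟫ / r + f x) ^ 2 + T x := by
      intro x
      rw [sum_eq_add_add_sum_erase hij, ← add_assoc,
        quadratic_rotation_identity hai.ne' haj.ne' hr.ne' hcs hac]
      simp only [f, T, hu, hw, haj', inner_add_left, inner_smul_left, RCLike.conj_to_real]
      ring
    have hQ' : ∀ x, ∑ k, (⟪v' k, x⟫ / a' k) ^ 2 = (⟪u, x⟫ / r) ^ 2 + T x := by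
      intro x
      rw [sum_eq_add_add_sum_erase hij, hvi, hai', hvj]
      congr 2
      exact Finset.sum_congr rfl fun k hk => by rw [hvk k hk, hak k hk]
    simp only [hQ] at hin hout
    obtain ⟨hin', hout'⟩ := sublevel_steinerSymmetral hun hK hc hr hf hT hin hout
    simp only [← hQ'] at hin' hout'
    have hpos : ∀ k, 0 < a' k := by
      intro k
      by_cases hk : k = i
      · simp [ha', hk, hr]
      by_cases hk' : k = j
      · rw [hk', haj']; positivity
      · simp [ha', hk, hk', ha]
    have hprod' : ∏ k, a' k = r ^ n := by
      rw [← hprod, prod_eq_mul_mul_prod_erase hij, prod_eq_mul_mul_prod_erase hij a, hai', haj',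
        Finset.prod_congr rfl hak]
      field_simp
    have hcard' : (Finset.univ.filter fun k => a' k ≠ r).card ≤ k := by
      have hsub : (Finset.univ.filter fun k => a' k ≠ r) ⊆
          (Finset.univ.filter fun k => a k ≠ r).erase i := by
        intro k hk
        simp only [Finset.mem_filter, Finset.mem_univ, true_and, Finset.mem_erase] at hk ⊢
        by_cases hki : k = i
        · exact absurd (hki ▸ hai') hk
        refine ⟨hki, ?_⟩
        by_cases hkj : k = j
        · exact hkj ▸ hj.ne
        · simpa [ha', hki, hkj] using hk
      have := Finset.card_le_card hsub
      rw [Finset.card_erase_of_mem (by simpa using hi.ne')] at this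
      omega
    obtain ⟨l, hl, hlu, h1, h2⟩ := ih v' a' (steinerSymmetral u K) hvo hpos hprod' hcard'
      (isCompact_steinerSymmetral hun hK hc) (convex_steinerSymmetral hun hK hc) hin' hout'
    exact ⟨u :: l, by simpa using hl, by simpa [hun] using hlu, h1, h2⟩

end Ellipsoids

/-- Any convex body of positive volume can be brought into bounded position by `2n` Steiner
symmetrizations. -/
lemma exists_list_sandwich {n : ℕ} (hn : 0 < n) {K : Set (EuclideanSpace ℝ (Fin n))}
    (hK : IsCompact K) (hc : Convex ℝ K) (hvol : volume K ≠ 0) :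
    ∃ (l : List (EuclideanSpace ℝ (Fin n))) (r : ℝ), l.length ≤ 2 * n ∧ (∀ u ∈ l, ‖u‖ = 1) ∧
      0 < r ∧ closedBall 0 (r / n) ⊆ l.foldl (fun S v => steinerSymmetral v S) K ∧
      l.foldl (fun S v => steinerSymmetral v S) K ⊆ closedBall 0 (n * r) := by
  have hn1 : (1 : ℝ) ≤ n := by exact_mod_cast hn
  let e : Fin n → EuclideanSpace ℝ (Fin n) := fun i => EuclideanSpace.single i 1
  have he : Orthonormal ℝ e := EuclideanSpace.orthonormal_single
  have hex : ∀ i x, ⟪e i, x⟫ = x i := fun i x => by simp [e, EuclideanSpace.inner_single_left]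
  have hl : ∀ u ∈ List.ofFn e, ‖u‖ = 1 := by
    rintro u hu
    obtain ⟨i, rfl⟩ := List.mem_ofFn.1 hu
    exact he.norm_eq_one i
  have hp : (List.ofFn e).Pairwise fun u v => ⟪u, v⟫ = 0 :=
    List.pairwise_ofFn.2 fun i j hij => he.inner_eq_zero hij.ne
  obtain ⟨hK', hc', hvol'⟩ := foldl_steinerSymmetral_invariants _ hl K hK hc
  have hsym : ∀ i, ∀ x ∈ (List.ofFn e).foldl (fun S v => steinerSymmetral v S) K,
      x - (2 * x i) • e i ∈ (List.ofFn e).foldl (fun S v => steinerSymmetral v S) K := by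
    intro i x hx
    have := reflection_mem_foldl _ hl hp K hK hc (e i) (List.mem_ofFn.2 ⟨i, rfl⟩) x hx
    rwa [reflection_apply_of_norm_one (he.norm_eq_one i), hex] at this
  set K' := (List.ofFn e).foldl (fun S v => steinerSymmetral v S) K with hKdef
  obtain ⟨a, ha, hbox, hax⟩ := exists_semiaxes hK' hc' (by rwa [hvol']) hsym
  have hprod : 0 < ∏ i, a i := Finset.prod_pos fun i _ => ha i
  set r : ℝ := (∏ i, a i) ^ ((n : ℝ)⁻¹) with hr
  have hr0 : 0 < r := Real.rpow_pos_of_pos hprod _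
  have hrn : ∏ i, a i = r ^ n := (Real.rpow_inv_natCast_pow hprod.le hn.ne').symm
  have hseg : ∀ i (t : ℝ), |t| ≤ 1 → t • a i • e i ∈ K' := by
    intro i t ht
    rw [abs_le] at ht
    have h1 := hsym i _ (hax i)
    have h2 := hc' (hax i) h1 (a := (1 + t) / 2) (b := (1 - t) / 2) (by linarith) (by linarith)
      (by ring)
    convert! h2 using 1
    simp
    module
  have hin : ∀ x, ∑ i, (⟪e i, x⟫ / a i) ^ 2 ≤ (1 / (n : ℝ)) ^ 2 → x ∈ K' := by
    intro x hx
    have hxi : ∀ i, |n * (x i / a i)| ≤ 1 := by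
      intro i
      have h1 : (⟪e i, x⟫ / a i) ^ 2 ≤ (1 / (n : ℝ)) ^ 2 :=
        (Finset.single_le_sum (f := fun i => (⟪e i, x⟫ / a i) ^ 2) (fun _ _ => sq_nonneg _)
          (Finset.mem_univ i)).trans hx
      have h2 := abs_le_of_sq_le_sq h1 (by positivity)
      rw [hex] at h2
      rw [abs_mul, abs_of_pos (by positivity : (0 : ℝ) < n)]
      rw [le_div_iff₀ (by positivity)] at h2
      linarith
    have h1 := hc'.sum_mem (t := Finset.univ) (w := fun _ : Fin n => (1 : ℝ) / n)
      (z := fun i => (n * (x i / a i)) • a i • e i) (fun _ _ => by positivity)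
      (by simp; field_simp) fun i _ => hseg i _ (hxi i)
    convert! h1 using 1
    ext k
    simp [e, Finset.sum_apply, Pi.single_apply]
    have := (ha k).ne'
    field_simp
  have hout : ∀ x ∈ K', ∑ i, (⟪e i, x⟫ / a i) ^ 2 ≤ (n : ℝ) ^ 2 := by
    intro x hx
    calc ∑ i, (⟪e i, x⟫ / a i) ^ 2 ≤ ∑ _i : Fin n, (1 : ℝ) := by
          refine Finset.sum_le_sum fun i _ => ?_
          rw [hex, sq_le_one_iff_abs_le_one, abs_div, abs_of_pos (ha i), div_le_one (ha i)]
          exact hbox x hx i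
      _ ≤ (n : ℝ) ^ 2 := by simp; nlinarith
  obtain ⟨l, hlen, hlu, h1, h2⟩ := exists_list_ellipsoid_to_ball hr0 n e a K' he ha hrn
    ((Finset.card_filter_le _ _).trans (by simp)) hK' hc' hin hout
  refine ⟨List.ofFn e ++ l, r, ?_, ?_, hr0, ?_, ?_⟩
  · rw [List.length_append, List.length_ofFn]; omega
  · intro u hu
    rcases List.mem_append.1 hu with hu | hu
    exacts [hl u hu, hlu u hu]
  · rw [List.foldl_append]
    intro x hx
    rw [mem_closedBall_zero_iff] at hx
    refine h1 x ?_
    refine pow_le_pow_left₀ (by positivity) ?_ 2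
    rw [div_le_div_iff₀ hr0 (by positivity)]
    rw [le_div_iff₀ (by positivity)] at hx
    linarith
  · rw [List.foldl_append]
    intro x hx
    rw [mem_closedBall_zero_iff]
    have := abs_le_of_sq_le_sq (h2 x hx) (by positivity)
    have := (le_abs_self _).trans this
    rwa [div_le_iff₀ hr0] at this

lemma symmetrization_count_le {n : ℕ} (hn : 2 ≤ n) {ε : ℝ} (hε : ε ∈ Set.Ioo (0 : ℝ) 1) {N : ℝ}
    (hN : N ≤ 2 * n + (2 ^ 17 * n ^ 10 / ε ^ 4 + 1)) :
    N ≤ (2 ^ 17 + 3) * (n : ℝ) ^ 13 * Real.log n ^ 3 / ε ^ ((4 : ℝ) + 2 / Real.log n) := by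
  obtain ⟨hε0, hε1⟩ := hε
  have hn2 : (2 : ℝ) ≤ n := by exact_mod_cast hn
  have hlog : (1 / 2 : ℝ) ≤ Real.log n := by
    have := Real.log_le_log (by norm_num) hn2
    have := Real.log_two_gt_d9
    linarith
  have hnlog : 1 ≤ (n : ℝ) * Real.log n := by nlinarith
  have hpow : ε ^ ((4 : ℝ) + 2 / Real.log n) ≤ ε ^ 4 := by
    rw [← Real.rpow_natCast]
    refine Real.rpow_le_rpow_of_exponent_ge hε0 hε1.le ?_
    have : 0 ≤ 2 / Real.log n := by positivity
    push_cast
    linarith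
  have hε4 : ε ^ 4 ≤ 1 := pow_le_one₀ hε0.le hε1.le
  have hn10 : (n : ℝ) ≤ n ^ 10 := le_self_pow₀ (by linarith) (by norm_num)
  have hq : (n : ℝ) ^ 10 ≤ n ^ 10 / ε ^ 4 := le_div_self (by positivity) (by positivity) hε4
  calc N ≤ (2 ^ 17 + 3) * (n ^ 10 / ε ^ 4) := by
        rw [mul_div_assoc] at hN
        linarith
    _ ≤ (2 ^ 17 + 3) * (n ^ 10 * ((n : ℝ) * Real.log n) ^ 3 / ε ^ ((4 : ℝ) + 2 / Real.log n)) := by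
        gcongr
        exact le_mul_of_one_le_right (by positivity) (one_le_pow₀ hnlog)
    _ = _ := by ring

/-- Rate of convergence of Steiner symmetrizations in the Nikodym metric:
`c n^13 (log n)^3 / ε^(4 + 2/log n)` symmetrizations suffice to bring a convex body of
the ball's volume within symmetric-difference distance `ε` of the unit ball. -/
theorem steiner_convergence_rate :
    ∃ c : ℝ, 0 < c ∧ ∀ (n : ℕ), 2 ≤ n →
      ∀ K : Set (EuclideanSpace ℝ (Fin n)), IsCompact K → Convex ℝ K →
        volume K = volume (closedBall (0 : EuclideanSpace ℝ (Fin n)) 1) →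
        ∀ ε : ℝ, ε ∈ Set.Ioo (0 : ℝ) 1 →
          ∃ (N : ℕ) (u : Fin N → EuclideanSpace ℝ (Fin n)),
            (∀ i, ‖u i‖ = 1) ∧
            (N : ℝ) ≤ c * (n : ℝ) ^ 13 * Real.log n ^ 3 /
              ε ^ ((4 : ℝ) + 2 / Real.log n) ∧
            (volume (symmDiff ((List.ofFn u).foldl (fun S v => steinerSymmetral v S) K)
                  (closedBall (0 : EuclideanSpace ℝ (Fin n)) 1))).toReal /
              (volume (closedBall (0 : EuclideanSpace ℝ (Fin n)) 1)).toReal < ε := by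
  refine ⟨2 ^ 17 + 3, by norm_num, fun n hn K hK hc hvol ε hε => ?_⟩
  have hn0 : 0 < n := by omega
  have hn' : (0 : ℝ) < n := by exact_mod_cast hn0
  have hε0 := hε.1
  have hVpos := measure_closedBall_pos volume (0 : EuclideanSpace ℝ (Fin n)) one_pos
  have hVtop : volume (closedBall (0 : EuclideanSpace ℝ (Fin n)) 1) ≠ ⊤ :=
    measure_closedBall_lt_top.ne
  obtain ⟨l₁, r, hlen₁, hl₁, hr, hin, hout⟩ :=
    exists_list_sandwich hn0 hK hc (by rw [hvol]; exact hVpos.ne')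
  obtain ⟨hK₁, hc₁, hvol₁⟩ := foldl_steinerSymmetral_invariants l₁ hl₁ K hK hc
  set K₁ := l₁.foldl (fun S v => steinerSymmetral v S) K with hK₁def
  rw [hvol] at hvol₁
  have hI := secondMoment_le hK₁ hout
  rw [hvol₁] at hI
  obtain ⟨l₂, hlen₂, hl₂, hlt⟩ := exists_list_symmDiff_lt hn0 hε0 hε.2
    (by positivity : 0 < r / n) ⌈(2 : ℝ) ^ 17 * n ^ 10 / ε ^ 4⌉₊ K₁ hK₁ hc₁ hvol₁ hin (by
      refine hI.trans ?_
      calc _ = (2 : ℝ) ^ 17 * n ^ 10 / ε ^ 4 * ((ε / (8 * n)) ^ 4 * (r / n) ^ 2 *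
            (volume (closedBall (0 : EuclideanSpace ℝ (Fin n)) 1)).toReal / (32 * n ^ 2)) := by
            field_simp
            ring
        _ ≤ _ := by
            gcongr
            exact Nat.le_ceil _)
  refine ⟨(l₁ ++ l₂).length, (l₁ ++ l₂).get, fun i => ?_, ?_, ?_⟩
  · rcases List.mem_append.1 (List.get_mem (l₁ ++ l₂) i) with h | h
    exacts [hl₁ _ h, hl₂ _ h]
  · refine symmetrization_count_le hn hε ?_
    rw [List.length_append, Nat.cast_add]
    refine add_le_add (by exact_mod_cast hlen₁) ?_
    exact (Nat.cast_le.2 hlen₂).trans (Nat.ceil_lt_add_one (by positivity)).le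
  · rw [List.ofFn_get, List.foldl_append, div_lt_iff₀ (ENNReal.toReal_pos hVpos.ne' hVtop)]
    exact hlt
end

section
/- Let n ≥ 2 and let K ⊂ ℝⁿ be a compact convex set with r·D_n ⊆ K ⊆ R·D_n for some 0 < r ≤ R. Let b : K → ℝ be a bounded Lipschitz function with mean zero with respect to the weight ρ, i.e. ∫_K b(x)·ρ(x) dx = 0, where ρ(x) = dist(x, ∂K). Then for every λ ∈ (2, ∞), setting β = (λ−2)/(λ−1) ∈ (0,1), one has ∫_K |b| ≤ C·(‖b‖_∞·|K|/β)^{1−1/λ} · (n·(R/r)·∫_K |∇b(x)|·ρ(x) dx)^{1/λ}, where C > 0 is a universal constant and ∇b denotes the (almost-everywhere defined) gradient of b. -/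
open MeasureTheory Pointwise Metric

/-- The Prékopa–Leindler inequality for a measure on a real vector space. -/
def PrekopaLeindler {E : Type*} [AddCommMonoid E] [Module ℝ E] [MeasurableSpace E]
    (μ : Measure E) : Prop :=
  ∀ t : ℝ, 0 < t → t < 1 → ∀ f g h : E → ENNReal, Measurable f → Measurable g → Measurable h →
    (∀ x y, f x ^ (1 - t) * g y ^ t ≤ h ((1 - t) • x + t • y)) →
    (∫⁻ x, f x ∂μ) ^ (1 - t) * (∫⁻ x, g x ∂μ) ^ t ≤ ∫⁻ x, h x ∂μ

theorem PrekopaLeindler.prod {E F : Type*} [AddCommMonoid E] [Module ℝ E] [MeasurableSpace E]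
    [AddCommMonoid F] [Module ℝ F] [MeasurableSpace F] {μ : Measure E} {ν : Measure F}
    [SFinite ν] (hμ : PrekopaLeindler μ) (hν : PrekopaLeindler ν) :
    PrekopaLeindler (μ.prod ν) := by
  intro t ht0 ht1 f g h hf hg hh H
  rw [lintegral_prod _ hf.aemeasurable, lintegral_prod _ hg.aemeasurable,
    lintegral_prod _ hh.aemeasurable]
  refine hμ t ht0 ht1 _ _ _ hf.lintegral_prod_right' hg.lintegral_prod_right'
    hh.lintegral_prod_right' fun x₁ x₂ => ?_
  exact hν t ht0 ht1 _ _ _ (hf.comp measurable_prodMk_left) (hg.comp measurable_prodMk_left)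
    (hh.comp measurable_prodMk_left) fun y₁ y₂ => H (x₁, y₁) (x₂, y₂)

theorem PrekopaLeindler.of_measurePreserving {E F : Type*} [AddCommMonoid E] [Module ℝ E]
    [MeasurableSpace E] [AddCommMonoid F] [Module ℝ F] [MeasurableSpace F] {μ : Measure E}
    {ν : Measure F} (hν : PrekopaLeindler ν) (e : F ≃ᵐ E) (he : MeasurePreserving e ν μ)
    (hlin : ∀ (a b : ℝ) (x y : F), e (a • x + b • y) = a • e x + b • e y) :
    PrekopaLeindler μ := by
  intro t ht0 ht1 f g h hf hg hh H
  rw [← he.lintegral_comp hf, ← he.lintegral_comp hg, ← he.lintegral_comp hh]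
  refine hν t ht0 ht1 _ _ _ (hf.comp e.measurable) (hg.comp e.measurable)
    (hh.comp e.measurable) fun x y => ?_
  rw [hlin]
  exact H _ _

/-- One-dimensional Brunn–Minkowski inequality for compact sets. -/
theorem volume_add_le_of_isCompact {t : ℝ} (ht0 : 0 < t) (ht1 : t < 1) {A B C : Set ℝ}
    (hA : IsCompact A) (hB : IsCompact B) (hAn : A.Nonempty) (hBn : B.Nonempty)
    (hC : ∀ x ∈ A, ∀ y ∈ B, (1 - t) * x + t * y ∈ C) :
    ENNReal.ofReal (1 - t) * volume A + ENNReal.ofReal t * volume B ≤ volume C := by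
  obtain ⟨a, haA, ha⟩ := hA.exists_isGreatest hAn
  obtain ⟨b, hbB, hb⟩ := hB.exists_isLeast hBn
  have ht1' : 0 < 1 - t := sub_pos.2 ht1
  have hvol : ∀ (c d : ℝ) (S : Set ℝ), 0 < c →
      volume ((fun x => c * x + d) '' S) = ENNReal.ofReal c * volume S := by
    intro c d S hc
    have : (fun x => c * x + d) '' S = (fun x => x + d) '' (c • S) := by
      rw [← Set.image_smul, Set.image_image]; rfl
    rw [this, Set.image_add_right, measure_preimage_add_right, Measure.addHaar_smul]
    simp [abs_of_pos hc]
  have hdis : AEDisjoint volume ((fun x => (1 - t) * x + t * b) '' A)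
      ((fun x => t * x + (1 - t) * a) '' B) := by
    refine measure_mono_null (t := {(1 - t) * a + t * b}) ?_ (by simp)
    rintro z ⟨⟨x, hx, rfl⟩, ⟨y, hy, hxy⟩⟩
    have h1 := mul_le_mul_of_nonneg_left (ha hx) ht1'.le
    have h2 := mul_le_mul_of_nonneg_left (hb hy) ht0.le
    simp only [Set.mem_singleton_iff] at *
    linarith
  have hmeas : NullMeasurableSet ((fun x => t * x + (1 - t) * a) '' B) volume :=
    (hB.image (by fun_prop)).measurableSet.nullMeasurableSet
  rw [← hvol (1 - t) (t * b) A ht1', ← hvol t ((1 - t) * a) B ht0, ← measure_union₀ hmeas hdis]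
  refine measure_mono ?_
  rintro z (⟨x, hx, rfl⟩ | ⟨y, hy, rfl⟩)
  · exact hC x hx b hbB
  · simpa only [add_comm] using hC a haA y hy

/-- One-dimensional Brunn–Minkowski inequality for measurable sets. -/
theorem volume_add_le_of_measurableSet {t : ℝ} (ht0 : 0 < t) (ht1 : t < 1) {A B C : Set ℝ}
    (hA : MeasurableSet A) (hB : MeasurableSet B) (hAn : A.Nonempty) (hBn : B.Nonempty)
    (hC : ∀ x ∈ A, ∀ y ∈ B, (1 - t) * x + t * y ∈ C) :
    ENNReal.ofReal (1 - t) * volume A + ENNReal.ofReal t * volume B ≤ volume C := by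
  obtain ⟨a, ha⟩ := hAn
  obtain ⟨b, hb⟩ := hBn
  rw [hA.measure_eq_iSup_isCompact, hB.measure_eq_iSup_isCompact]
  simp only [ENNReal.mul_iSup, iSup_and']
  refine ENNReal.biSup_add_biSup_le' ⟨{a}, by simpa using ha⟩ ⟨{b}, by simpa using hb⟩ ?_
  rintro A' ⟨hA', hA'c⟩ B' ⟨hB', hB'c⟩
  calc _ ≤ ENNReal.ofReal (1 - t) * volume (insert a A')
        + ENNReal.ofReal t * volume (insert b B') := by
        gcongr <;> exact Set.subset_insert _ _
    _ ≤ _ := volume_add_le_of_isCompact ht0 ht1 (hA'c.insert a) (hB'c.insert b)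
        (Set.insert_nonempty _ _) (Set.insert_nonempty _ _) fun x hx y hy =>
          hC x (Set.insert_subset ha hA' hx) y (Set.insert_subset hb hB' hy)

theorem lintegral_eq_lintegral_meas_ofReal_lt {α : Type*} [MeasurableSpace α] (μ : Measure α)
    {f : α → ENNReal} (hf : Measurable f) (hf_top : ∀ x, f x ≠ ⊤) :
    ∫⁻ x, f x ∂μ = ∫⁻ s in Set.Ioi (0 : ℝ), μ {x | ENNReal.ofReal s < f x} := by
  have h1 : ∀ x, f x = ENNReal.ofReal (f x).toReal := fun x =>
    (ENNReal.ofReal_toReal (hf_top x)).symm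
  conv_lhs => rw [lintegral_congr h1]
  rw [lintegral_eq_lintegral_meas_lt μ (Filter.Eventually.of_forall fun x => ENNReal.toReal_nonneg)
    hf.ennreal_toReal.aemeasurable]
  refine setLIntegral_congr_fun measurableSet_Ioi fun s hs => ?_
  simp only [ENNReal.ofReal_lt_iff_lt_toReal (le_of_lt hs) (hf_top _)]

theorem prekopaLeindler_real_of_iSup_eq_one {t : ℝ} (ht0 : 0 < t) (ht1 : t < 1)
    {f g h : ℝ → ENNReal} (hf : Measurable f) (hg : Measurable g) (hh : Measurable h)
    (hf1 : ⨆ x, f x = 1) (hg1 : ⨆ x, g x = 1)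
    (H : ∀ x y, f x ^ (1 - t) * g y ^ t ≤ h ((1 - t) * x + t * y)) :
    ENNReal.ofReal (1 - t) * (∫⁻ x, f x) + ENNReal.ofReal t * (∫⁻ x, g x) ≤ ∫⁻ x, h x := by
  have ht1' : 0 < 1 - t := sub_pos.2 ht1
  have hfle : ∀ x, f x ≤ 1 := fun x => hf1 ▸ le_iSup f x
  have hgle : ∀ x, g x ≤ 1 := fun x => hg1 ▸ le_iSup g x
  have hmin : ∫⁻ x, min (h x) 1 ≤ ∫⁻ x, h x := lintegral_mono fun x => min_le_left _ _
  refine le_trans ?_ hmin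
  rw [lintegral_eq_lintegral_meas_ofReal_lt _ hf fun x => ne_top_of_le_ne_top (by simp) (hfle x),
    lintegral_eq_lintegral_meas_ofReal_lt _ hg fun x => ne_top_of_le_ne_top (by simp) (hgle x),
    lintegral_eq_lintegral_meas_ofReal_lt _ (hh.min measurable_const)
      fun x => ne_top_of_le_ne_top (b := 1) (by simp) (min_le_right _ _),
    ← lintegral_const_mul' _ _ ENNReal.ofReal_ne_top,
    ← lintegral_const_mul' _ _ ENNReal.ofReal_ne_top]
  rw [← lintegral_add_left]
  · refine setLIntegral_mono' measurableSet_Ioi fun s hs => ?_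
    by_cases hs1 : ENNReal.ofReal s < 1
    · refine volume_add_le_of_measurableSet ht0 ht1 (measurableSet_lt measurable_const hf)
        (measurableSet_lt measurable_const hg) ?_ ?_ ?_
      · exact lt_iSup_iff.1 (hf1 ▸ hs1)
      · exact lt_iSup_iff.1 (hg1 ▸ hs1)
      · intro x hx y hy
        refine lt_min (lt_of_lt_of_le ?_ (H x y)) hs1
        have hs0 : ENNReal.ofReal s ≠ 0 := by simpa using hs
        calc ENNReal.ofReal s = ENNReal.ofReal s ^ (1 - t) * ENNReal.ofReal s ^ t := by
              rw [← ENNReal.rpow_add _ _ hs0 ENNReal.ofReal_ne_top]; simp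
          _ < f x ^ (1 - t) * g y ^ t :=
              ENNReal.mul_lt_mul (ENNReal.rpow_lt_rpow hx ht1') (ENNReal.rpow_lt_rpow hy ht0)
    · have e1 : {x | ENNReal.ofReal s < f x} = ∅ :=
        Set.eq_empty_of_forall_notMem fun x hx => hs1 (lt_of_lt_of_le hx (hfle x))
      have e2 : {x | ENNReal.ofReal s < g x} = ∅ :=
        Set.eq_empty_of_forall_notMem fun x hx => hs1 (lt_of_lt_of_le hx (hgle x))
      simp [e1, e2]
  · refine Measurable.const_mul (Antitone.measurable fun s s' hss => measure_mono fun x hx => ?_) _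
    exact lt_of_le_of_lt (ENNReal.ofReal_le_ofReal hss) hx

theorem prekopaLeindler_real_of_bounded {t : ℝ} (ht0 : 0 < t) (ht1 : t < 1)
    {f g h : ℝ → ENNReal} (hf : Measurable f) (hg : Measurable g) (hh : Measurable h)
    (hf_top : ⨆ x, f x ≠ ⊤) (hg_top : ⨆ x, g x ≠ ⊤)
    (H : ∀ x y, f x ^ (1 - t) * g y ^ t ≤ h ((1 - t) * x + t * y)) :
    (∫⁻ x, f x) ^ (1 - t) * (∫⁻ x, g x) ^ t ≤ ∫⁻ x, h x := by
  have ht1' : 0 < 1 - t := sub_pos.2 ht1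
  set a := ⨆ x, f x with ha
  set b := ⨆ x, g x with hb
  by_cases ha0 : a = 0
  · have : f = 0 := funext fun x => le_antisymm ((le_iSup f x).trans_eq ha0) zero_le
    simp [this, ENNReal.zero_rpow_of_pos ht1']
  by_cases hb0 : b = 0
  · have : g = 0 := funext fun x => le_antisymm ((le_iSup g x).trans_eq hb0) zero_le
    simp [this, ENNReal.zero_rpow_of_pos ht0]
  set c := a ^ (1 - t) * b ^ t with hc
  have hc0 : c ≠ 0 := mul_ne_zero (by simp [ha0, hf_top]) (by simp [hb0, hg_top])
  have hct : c ≠ ⊤ := ENNReal.mul_ne_top (ENNReal.rpow_ne_top_of_nonneg ht1'.le hf_top)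
    (ENNReal.rpow_ne_top_of_nonneg ht0.le hg_top)
  have key := prekopaLeindler_real_of_iSup_eq_one ht0 ht1 (hf.mul_const a⁻¹) (hg.mul_const b⁻¹)
    (hh.mul_const c⁻¹) (by rw [← ENNReal.iSup_mul, ENNReal.mul_inv_cancel ha0 hf_top])
    (by rw [← ENNReal.iSup_mul, ENNReal.mul_inv_cancel hb0 hg_top]) (fun x y => by
      calc _ = (f x ^ (1 - t) * g y ^ t) * c⁻¹ := by
            rw [ENNReal.mul_rpow_of_nonneg _ _ ht1'.le, ENNReal.mul_rpow_of_nonneg _ _ ht0.le,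
              ENNReal.inv_rpow, ENNReal.inv_rpow, hc, ENNReal.mul_inv]
            · ring
            · left; simp [ha0, hf_top]
            · left; exact ENNReal.rpow_ne_top_of_nonneg ht1'.le hf_top
        _ ≤ _ := by gcongr; exact H x y)
  rw [lintegral_mul_const _ hf, lintegral_mul_const _ hg, lintegral_mul_const _ hh] at key
  set F := ∫⁻ x, f x
  set G := ∫⁻ x, g x
  have young := ENNReal.young_inequality ((F * a⁻¹) ^ (1 - t)) ((G * b⁻¹) ^ t)
    (p := (1 - t)⁻¹) (q := t⁻¹) ⟨by simp, by positivity, by positivity⟩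
  rw [← ENNReal.rpow_mul, ← ENNReal.rpow_mul, mul_inv_cancel₀ ht1'.ne', mul_inv_cancel₀ ht0.ne',
    ENNReal.rpow_one, ENNReal.rpow_one, ENNReal.ofReal_inv_of_pos ht1',
    ENNReal.ofReal_inv_of_pos ht0, div_eq_mul_inv, div_eq_mul_inv, inv_inv, inv_inv,
    mul_comm _ (ENNReal.ofReal (1 - t)), mul_comm _ (ENNReal.ofReal t)] at young
  have := young.trans key
  rw [← div_eq_mul_inv _ c, ENNReal.le_div_iff_mul_le (Or.inl hc0) (Or.inl hct)] at this
  refine le_trans (le_of_eq ?_) this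
  rw [hc]
  calc F ^ (1 - t) * G ^ t
      = (F * a⁻¹ * a) ^ (1 - t) * (G * b⁻¹ * b) ^ t := by
        rw [mul_assoc, mul_assoc, ENNReal.inv_mul_cancel ha0 hf_top,
          ENNReal.inv_mul_cancel hb0 hg_top, mul_one, mul_one]
    _ = _ := by
        rw [ENNReal.mul_rpow_of_nonneg _ a ht1'.le, ENNReal.mul_rpow_of_nonneg _ b ht0.le]
        ring

theorem prekopaLeindler_real : PrekopaLeindler (volume : Measure ℝ) := by
  intro t ht0 ht1 f g h hf hg hh H
  have ht1' : 0 < 1 - t := sub_pos.2 ht1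
  by_cases hF : ∫⁻ x, f x = 0
  · simp [hF, ENNReal.zero_rpow_of_pos ht1']
  by_cases hG : ∫⁻ x, g x = 0
  · simp [hG, ENNReal.zero_rpow_of_pos ht0]
  have trunc : ∀ u : ℝ → ENNReal, Measurable u →
      Filter.Tendsto (fun k : ℕ => ∫⁻ x, min (u x) k) Filter.atTop (nhds (∫⁻ x, u x)) := by
    intro u hu
    refine lintegral_tendsto_of_tendsto_of_monotone
      (fun k => (hu.min measurable_const).aemeasurable)
      (Filter.Eventually.of_forall fun x i j hij => min_le_min le_rfl (by exact_mod_cast hij))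
      (Filter.Eventually.of_forall fun x => ?_)
    have := (tendsto_const_nhds (x := u x)).min ENNReal.tendsto_nat_nhds_top
    simpa using this
  have lim := ENNReal.Tendsto.mul
    ((ENNReal.continuous_rpow_const (y := 1 - t)).continuousAt.tendsto.comp (trunc f hf))
    (Or.inl (by simp [hF, ht1.le]))
    ((ENNReal.continuous_rpow_const (y := t)).continuousAt.tendsto.comp (trunc g hg))
    (Or.inl (by simp [hG, ht0.le]))
  refine le_of_tendsto' lim fun k => ?_
  have hb : ∀ u : ℝ → ENNReal, ⨆ x, min (u x) (k : ENNReal) ≠ ⊤ := fun u =>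
    ne_top_of_le_ne_top (ENNReal.natCast_ne_top k) (iSup_le fun x => min_le_right _ _)
  refine prekopaLeindler_real_of_bounded ht0 ht1 (hf.min measurable_const)
    (hg.min measurable_const) hh (hb f) (hb g) fun x y => le_trans ?_ (H x y)
  exact mul_le_mul' (ENNReal.rpow_le_rpow (min_le_left _ _) ht1'.le)
    (ENNReal.rpow_le_rpow (min_le_left _ _) ht0.le)

theorem prekopaLeindler_pi (n : ℕ) : PrekopaLeindler (volume : Measure (Fin n → ℝ)) := by
  induction n with
  | zero =>
    intro t ht0 ht1 f g h _ _ _ H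
    have hv : (volume : Measure (Fin 0 → ℝ)) = Measure.dirac default := by
      rw [volume_pi]; exact Measure.pi_of_empty _ _
    have h0 := H default default
    rw [Subsingleton.elim ((1 - t) • default + t • default) (default : Fin 0 → ℝ)] at h0
    simpa only [hv, lintegral_dirac] using h0
  | succ n ih =>
    refine (prekopaLeindler_real.prod ih).of_measurePreserving
      (MeasurableEquiv.piFinSuccAbove (fun _ => ℝ) 0).symm
      (volume_preserving_piFinSuccAbove (fun _ => ℝ) 0).symm fun a b x y => ?_
    ext i
    refine Fin.cases ?_ (fun j => ?_) i <;> simp [MeasurableEquiv.piFinSuccAbove]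

theorem prekopaLeindler_euclideanSpace (n : ℕ) :
    PrekopaLeindler (volume : Measure (EuclideanSpace ℝ (Fin n))) :=
  (prekopaLeindler_pi n).of_measurePreserving
    (MeasurableEquiv.toLp 2 (Fin n → ℝ))
    (EuclideanSpace.volume_preserving_symm_measurableEquiv_toLp (Fin n)).symm fun _ _ _ _ => rfl

/-- The oscillation of `b` at scale `s` around a point. -/
noncomputable def scaleOsc {E : Type*} [NormedAddCommGroup E] [NormedSpace ℝ E]
    (b : E → ℝ) (s : ℝ) (z : E) : ℝ :=
  ⨆ v : closedBall (0 : E) 1, |b (z + s • (v : E)) - b z|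

section scaleOsc

variable {E : Type*} [NormedAddCommGroup E] [NormedSpace ℝ E] {b : E → ℝ} {M : NNReal}

theorem LipschitzWith.abs_sub_le_mul_of_mem_closedBall (hb : LipschitzWith M b) {s : ℝ}
    (hs : 0 ≤ s) (z : E) (v : closedBall (0 : E) 1) : |b (z + s • (v : E)) - b z| ≤ M * s := by
  have hv : ‖(v : E)‖ ≤ 1 := mem_closedBall_zero_iff.1 v.2
  have h := hb.dist_le_mul (z + s • (v : E)) z
  rw [Real.dist_eq, dist_eq_norm, add_sub_cancel_left, norm_smul, Real.norm_of_nonneg hs] at h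
  refine h.trans ?_
  gcongr
  exact mul_le_of_le_one_right hs hv

theorem LipschitzWith.bddAbove_range_scaleOsc (hb : LipschitzWith M b) {s : ℝ} (hs : 0 ≤ s)
    (z : E) : BddAbove (Set.range fun v : closedBall (0 : E) 1 => |b (z + s • (v : E)) - b z|) := by
  refine ⟨M * s, ?_⟩
  rintro _ ⟨v, rfl⟩
  exact hb.abs_sub_le_mul_of_mem_closedBall hs z v

theorem scaleOsc_nonneg (b : E → ℝ) (s : ℝ) (z : E) : 0 ≤ scaleOsc b s z :=
  Real.iSup_nonneg fun _ => abs_nonneg _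

theorem scaleOsc_le {s c : ℝ} {z : E} (h : ∀ v : E, ‖v‖ ≤ 1 → |b (z + s • v) - b z| ≤ c) :
    scaleOsc b s z ≤ c := by
  have : Nonempty (closedBall (0 : E) 1) := ⟨⟨0, by simp⟩⟩
  exact ciSup_le fun v => h v (mem_closedBall_zero_iff.1 v.2)

theorem LipschitzWith.scaleOsc_le_mul (hb : LipschitzWith M b) {s : ℝ} (hs : 0 ≤ s) (z : E) :
    scaleOsc b s z ≤ M * s :=
  scaleOsc_le fun v hv =>
    hb.abs_sub_le_mul_of_mem_closedBall hs z ⟨v, mem_closedBall_zero_iff.2 hv⟩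

theorem LipschitzWith.abs_sub_le_scaleOsc (hb : LipschitzWith M b) {s : ℝ} (hs : 0 ≤ s) (z : E)
    {v : E} (hv : ‖v‖ ≤ 1) : |b (z + s • v) - b z| ≤ scaleOsc b s z :=
  le_ciSup (hb.bddAbove_range_scaleOsc hs z)
    (⟨v, mem_closedBall_zero_iff.2 hv⟩ : closedBall (0 : E) 1)

theorem LipschitzWith.measurable_scaleOsc [MeasurableSpace E] [BorelSpace E]
    (hb : LipschitzWith M b) {s : ℝ} (hs : 0 ≤ s) : Measurable (scaleOsc b s) := by
  have hc := hb.continuous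
  exact (lowerSemicontinuous_ciSup (hb.bddAbove_range_scaleOsc hs)
    fun v => Continuous.lowerSemicontinuous (by fun_prop)).measurable

theorem DifferentiableAt.eventually_scaleOsc_le {z : E} (hb : DifferentiableAt ℝ b z) {ε : ℝ}
    (hε : 0 < ε) : ∀ᶠ s in nhdsWithin 0 (Set.Ioi (0 : ℝ)),
      scaleOsc b s z ≤ (‖fderiv ℝ b z‖ + ε) * s := by
  have h := hb.hasFDerivAt.isLittleO.def hε
  obtain ⟨δ, hδ, hball⟩ := Metric.eventually_nhds_iff.1 h
  filter_upwards [Ioo_mem_nhdsGT hδ] with s hs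
  refine scaleOsc_le fun v hv => ?_
  have hsv : ‖s • v‖ ≤ s := by
    rw [norm_smul, Real.norm_of_nonneg hs.1.le]
    exact mul_le_of_le_one_right hs.1.le hv
  have h1 := hball (y := z + s • v)
    (by rw [dist_eq_norm, add_sub_cancel_left]; exact hsv.trans_lt hs.2)
  rw [add_sub_cancel_left, Real.norm_eq_abs] at h1
  have h2 := (fderiv ℝ b z).le_opNorm (s • v)
  rw [Real.norm_eq_abs] at h2
  calc |b (z + s • v) - b z|
      ≤ |b (z + s • v) - b z - fderiv ℝ b z (s • v)| + |fderiv ℝ b z (s • v)| := by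
        simpa using abs_add_le (b (z + s • v) - b z - fderiv ℝ b z (s • v)) (fderiv ℝ b z (s • v))
    _ ≤ (‖fderiv ℝ b z‖ + ε) * ‖s • v‖ := by linarith
    _ ≤ _ := by gcongr

end scaleOsc

/-- An expansion property of a measure `ν`: the `D * t`-neighbourhood of a set `A` has measure at
least `ν A ^ (1 - t) * ν univ ^ t`. Log-concave measures on sets of diameter `D` have it. -/
def IsExpanding {E : Type*} [NormedAddCommGroup E] [NormedSpace ℝ E] [MeasurableSpace E]
    (D : ℝ) (ν : Measure E) : Prop :=
  ∀ t : ℝ, 0 < t → t < 1 → ∀ A U : Set E, MeasurableSet A → MeasurableSet U →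
    (∀ x ∈ A, ∀ v : E, ‖v‖ ≤ 1 → x + (D * t) • v ∈ U) → ν A ^ (1 - t) * ν Set.univ ^ t ≤ ν U

namespace IsExpanding

variable {E : Type*} [NormedAddCommGroup E] [NormedSpace ℝ E] [MeasurableSpace E] [BorelSpace E]
  {D : ℝ} {ν : Measure E} {b : E → ℝ} {M : NNReal}

theorem lintegral_posPart_le (hν : IsExpanding D ν) (hD : 0 ≤ D) (hb : LipschitzWith M b)
    (hhalf : 2 * ν {x | 0 < b x} ≤ ν Set.univ) {t : ℝ} (ht0 : 0 < t) (ht1 : t < 1) :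
    2 ^ t * ∫⁻ x, ENNReal.ofReal (b x) ∂ν
      ≤ ∫⁻ x, ENNReal.ofReal (max (b x) 0 + scaleOsc b (D * t) x) ∂ν := by
  have hs : 0 ≤ D * t := by positivity
  have hbm : Measurable b := hb.continuous.measurable
  have hom := hb.measurable_scaleOsc hs
  have hgm : Measurable fun x => ENNReal.ofReal (max (b x) 0 + scaleOsc b (D * t) x) := by
    fun_prop
  rw [lintegral_eq_lintegral_meas_ofReal_lt ν hbm.ennreal_ofReal fun x => ENNReal.ofReal_ne_top,
    lintegral_eq_lintegral_meas_ofReal_lt ν hgm fun x => ENNReal.ofReal_ne_top,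
    ← lintegral_const_mul' _ _ (ENNReal.rpow_ne_top_of_nonneg ht0.le (by simp))]
  refine setLIntegral_mono' measurableSet_Ioi fun s hs0 => ?_
  rw [Set.mem_Ioi] at hs0
  set A := {x | ENNReal.ofReal s < ENNReal.ofReal (b x)} with hA
  have hAb : ∀ x ∈ A, s < b x := fun x hx => (ENNReal.ofReal_lt_ofReal_iff_of_nonneg hs0.le).1 hx
  have hAhalf : 2 * ν A ≤ ν Set.univ := by
    refine le_trans ?_ hhalf
    gcongr
    exact fun x hx => hs0.trans (hAb x hx)
  refine le_trans ?_ (hν t ht0 ht1 A _ (measurableSet_lt measurable_const hbm.ennreal_ofReal)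
    (measurableSet_lt measurable_const hgm) fun x hx v hv => ?_)
  · calc 2 ^ t * ν A = ν A ^ (1 - t) * (2 * ν A) ^ t := by
          rw [ENNReal.mul_rpow_of_nonneg _ _ ht0.le, mul_left_comm, ← ENNReal.rpow_add_of_nonneg _ _
            (sub_pos.2 ht1).le ht0.le]
          simp
      _ ≤ _ := by gcongr
  · rw [Set.mem_ofPred_eq, ENNReal.ofReal_lt_ofReal_iff_of_nonneg hs0.le]
    have h1 := hb.abs_sub_le_scaleOsc hs (x + (D * t) • v) (v := -v) (by rwa [norm_neg])
    rw [smul_neg, add_neg_cancel_right] at h1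
    have h2 := le_abs_self (b x - b (x + (D * t) • v))
    have h3 := hAb x hx
    have h4 := le_max_left (b (x + (D * t) • v)) 0
    linarith

theorem log_two_mul_lintegral_le [IsFiniteMeasure ν] (hν : IsExpanding D ν) (hD : 0 ≤ D)
    (hb : LipschitzWith M b) (hint : Integrable b ν)
    (hhalf : 2 * ν {x | 0 < b x} ≤ ν Set.univ) {t : ℝ} (ht0 : 0 < t) (ht1 : t < 1) :
    ENNReal.ofReal (Real.log 2) * ∫⁻ x, ENNReal.ofReal (b x) ∂ν
      ≤ ∫⁻ x, ENNReal.ofReal (scaleOsc b (D * t) x / t) ∂ν := by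
  have h := hν.lintegral_posPart_le hD hb hhalf ht0 ht1
  have hfin : ∫⁻ x, ENNReal.ofReal (b x) ∂ν ≠ ⊤ := hint.lintegral_lt_top.ne
  have hsplit : ∫⁻ x, ENNReal.ofReal (max (b x) 0 + scaleOsc b (D * t) x) ∂ν
      = ∫⁻ x, ENNReal.ofReal (b x) ∂ν + ∫⁻ x, ENNReal.ofReal (scaleOsc b (D * t) x) ∂ν := by
    rw [← lintegral_add_left hb.continuous.measurable.ennreal_ofReal]
    refine lintegral_congr fun x => ?_
    rw [ENNReal.ofReal_add (le_max_right _ _) (scaleOsc_nonneg _ _ _), ENNReal.ofReal_max]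
    simp
  have hpow : 1 + ENNReal.ofReal (t * Real.log 2) ≤ 2 ^ t := by
    rw [← ENNReal.ofReal_one, ← ENNReal.ofReal_add zero_le_one (by positivity),
      show (2 : ENNReal) = ENNReal.ofReal 2 by simp, ENNReal.ofReal_rpow_of_pos two_pos]
    refine ENNReal.ofReal_le_ofReal ?_
    rw [Real.rpow_def_of_pos two_pos]
    have := Real.add_one_le_exp (Real.log 2 * t)
    linarith
  have h2 : ∫⁻ x, ENNReal.ofReal (b x) ∂ν
        + ENNReal.ofReal (t * Real.log 2) * ∫⁻ x, ENNReal.ofReal (b x) ∂ν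
      ≤ ∫⁻ x, ENNReal.ofReal (b x) ∂ν + ∫⁻ x, ENNReal.ofReal (scaleOsc b (D * t) x) ∂ν := by
    rw [← hsplit]
    refine le_trans (le_of_eq ?_) ((mul_le_mul_left hpow _).trans h)
    ring
  have h3 := (ENNReal.add_le_add_iff_left hfin).1 h2
  calc _ = ENNReal.ofReal t⁻¹ * (ENNReal.ofReal (t * Real.log 2)
        * ∫⁻ x, ENNReal.ofReal (b x) ∂ν) := by
        rw [← mul_assoc, ← ENNReal.ofReal_mul (by positivity), inv_mul_cancel_left₀ ht0.ne']
    _ ≤ ENNReal.ofReal t⁻¹ * ∫⁻ x, ENNReal.ofReal (scaleOsc b (D * t) x) ∂ν := by gcongr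
    _ = _ := by
        rw [← lintegral_const_mul' _ _ ENNReal.ofReal_ne_top]
        refine lintegral_congr fun x => ?_
        rw [← ENNReal.ofReal_mul (by positivity), div_eq_inv_mul]

theorem log_two_mul_lintegral_le_fderiv [FiniteDimensional ℝ E] {μ : Measure E}
    [μ.IsAddHaarMeasure] [IsFiniteMeasure ν] (hac : ν ≪ μ) (hν : IsExpanding D ν) (hD : 0 < D)
    (hb : LipschitzWith M b) (hint : Integrable b ν)
    (hhalf : 2 * ν {x | 0 < b x} ≤ ν Set.univ) :
    ENNReal.ofReal (Real.log 2) * ∫⁻ x, ENNReal.ofReal (b x) ∂ν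
      ≤ ∫⁻ x, ENNReal.ofReal (D * ‖fderiv ℝ b x‖) ∂ν := by
  set τ : ℕ → ℝ := fun k => 1 / ((k : ℝ) + 2) with hτ
  have hτ0 : ∀ k, 0 < τ k := fun k => by positivity
  have hτ1 : ∀ k, τ k < 1 := fun k => by
    rw [hτ]; simp only; rw [div_lt_one (by positivity)]; linarith [Nat.cast_nonneg (α := ℝ) k]
  have hτlim : Filter.Tendsto (fun k => D * τ k) Filter.atTop (nhdsWithin 0 (Set.Ioi 0)) := by
    refine tendsto_nhdsWithin_iff.2 ⟨?_, Filter.Eventually.of_forall fun k =>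
      mul_pos hD (hτ0 k)⟩
    have h1 : Filter.Tendsto τ Filter.atTop (nhds 0) := by
      have := (tendsto_one_div_add_atTop_nhds_zero_nat (𝕜 := ℝ)).comp (Filter.tendsto_add_atTop_nat 1)
      refine this.congr fun k => ?_
      simp only [hτ, Function.comp, Nat.cast_add, Nat.cast_one]
      ring_nf
    simpa using h1.const_mul D
  have hle : ∀ k, ENNReal.ofReal (Real.log 2) * ∫⁻ x, ENNReal.ofReal (b x) ∂ν
      ≤ ∫⁻ x, ENNReal.ofReal (scaleOsc b (D * τ k) x / τ k) ∂ν := fun k =>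
    hν.log_two_mul_lintegral_le hD.le hb hint hhalf (hτ0 k) (hτ1 k)
  have hlimsup : _ ≤ Filter.limsup (fun k => ∫⁻ x, ENNReal.ofReal (scaleOsc b (D * τ k) x / τ k) ∂ν)
      Filter.atTop := Filter.le_limsup_of_le ⟨⊤, by simp⟩ fun c hc => by
    obtain ⟨k, hk⟩ := hc.exists
    exact (hle k).trans hk
  refine hlimsup.trans ((limsup_lintegral_le (fun _ => ENNReal.ofReal (M * D)) (fun k => ?_)
    (fun k => Filter.Eventually.of_forall fun x => ?_) ?_).trans (lintegral_mono_ae ?_))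
  · exact ((hb.measurable_scaleOsc (mul_pos hD (hτ0 k)).le).div_const _).ennreal_ofReal
  · refine ENNReal.ofReal_le_ofReal ((div_le_iff₀ (hτ0 k)).2 ?_)
    exact (hb.scaleOsc_le_mul (mul_pos hD (hτ0 k)).le x).trans_eq (by ring)
  · rw [lintegral_const]
    exact ENNReal.mul_ne_top ENNReal.ofReal_ne_top (measure_ne_top _ _)
  · filter_upwards [hac.ae_le (hb.ae_differentiableAt (μ := μ))] with x hx
    have hε : ∀ ε > 0, Filter.limsup (fun k => ENNReal.ofReal (scaleOsc b (D * τ k) x / τ k))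
        Filter.atTop ≤ ENNReal.ofReal (D * (‖fderiv ℝ b x‖ + ε)) := fun ε hε => by
      refine Filter.limsup_le_of_le (by isBoundedDefault) ?_
      filter_upwards [hτlim.eventually (hx.eventually_scaleOsc_le hε)] with k hk
      refine ENNReal.ofReal_le_ofReal ((div_le_iff₀ (hτ0 k)).2 (hk.trans_eq (by ring)))
    have hcont : Filter.Tendsto (fun ε : ℝ => ENNReal.ofReal (D * (‖fderiv ℝ b x‖ + ε)))
        (nhdsWithin 0 (Set.Ioi 0)) (nhds (ENNReal.ofReal (D * (‖fderiv ℝ b x‖ + 0)))) :=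
      ((ENNReal.continuous_ofReal.comp (by fun_prop)).tendsto (0 : ℝ)).mono_left nhdsWithin_le_nhds
    rw [add_zero] at hcont
    exact ge_of_tendsto hcont (by filter_upwards [self_mem_nhdsWithin] with ε h using hε ε h)

theorem log_two_mul_integral_posPart_le [FiniteDimensional ℝ E] {μ : Measure E}
    [μ.IsAddHaarMeasure] [IsFiniteMeasure ν] (hac : ν ≪ μ) (hν : IsExpanding D ν) (hD : 0 < D)
    (hb : LipschitzWith M b) (hint : Integrable b ν)
    (hhalf : 2 * ν {x | 0 < b x} ≤ ν Set.univ) :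
    Real.log 2 * ∫ x, max (b x) 0 ∂ν ≤ D * ∫ x, ‖fderiv ℝ b x‖ ∂ν := by
  have hmeas : Measurable fun x => ‖fderiv ℝ b x‖ := (measurable_fderiv ℝ b).norm
  have hgrad : Integrable (fun x => ‖fderiv ℝ b x‖) ν :=
    Integrable.of_bound hmeas.aestronglyMeasurable M (Filter.Eventually.of_forall fun x => by
      simpa using norm_fderiv_le_of_lipschitz ℝ hb)
  have h := hν.log_two_mul_lintegral_le_fderiv hac hD hb hint hhalf
  have e1 : ∫⁻ x, ENNReal.ofReal (b x) ∂ν = ENNReal.ofReal (∫ x, max (b x) 0 ∂ν) := by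
    rw [ofReal_integral_eq_lintegral_ofReal hint.pos_part
      (Filter.Eventually.of_forall fun x => le_max_right _ _)]
    simp [ENNReal.ofReal_max]
  have hlog : 0 ≤ Real.log 2 := by positivity
  rw [e1, ← ofReal_integral_eq_lintegral_ofReal (hgrad.const_mul D)
    (Filter.Eventually.of_forall fun x => by positivity), ← ENNReal.ofReal_mul hlog,
    integral_const_mul, ENNReal.ofReal_le_ofReal_iff] at h
  · exact h
  · exact mul_nonneg hD.le (integral_nonneg fun x => norm_nonneg _)

/-- `L¹` Poincaré inequality for measures with the expansion property. -/
theorem log_two_mul_integral_abs_le [FiniteDimensional ℝ E] {μ : Measure E}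
    [μ.IsAddHaarMeasure] [IsFiniteMeasure ν] (hac : ν ≪ μ) (hν : IsExpanding D ν) (hD : 0 < D)
    (hb : LipschitzWith M b) (hint : Integrable b ν) (hmean : ∫ x, b x ∂ν = 0) :
    Real.log 2 * ∫ x, |b x| ∂ν ≤ 2 * D * ∫ x, ‖fderiv ℝ b x‖ ∂ν := by
  have hpos : ∀ u : E → ℝ, LipschitzWith M u → Integrable u ν → ∫ x, u x ∂ν = 0 →
      2 * ν {x | 0 < u x} ≤ ν Set.univ →
      Real.log 2 * ∫ x, |u x| ∂ν ≤ 2 * D * ∫ x, ‖fderiv ℝ u x‖ ∂ν := by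
    intro u hu hui hu0 hhalf
    have h := hν.log_two_mul_integral_posPart_le hac hD hu hui hhalf
    have e : ∫ x, |u x| ∂ν = 2 * ∫ x, max (u x) 0 ∂ν := by
      have hsub := integral_sub (hui.pos_part.const_mul 2) hui
      rw [hu0, sub_zero, integral_const_mul] at hsub
      rw [← hsub]
      refine integral_congr_ae (Filter.Eventually.of_forall fun x => ?_)
      simp only
      rcases le_total (u x) 0 with h0 | h0
      · rw [abs_of_nonpos h0, max_eq_right h0]; ring
      · rw [abs_of_nonneg h0, max_eq_left h0]; ring
    rw [e]
    linarith
  have hsum : ν {x | 0 < b x} + ν {x | 0 < -b x} ≤ ν Set.univ := by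
    have hdis : Disjoint {x | 0 < b x} {x | 0 < -b x} :=
      Set.disjoint_left.2 fun x h1 h2 => by
        simp only [Set.mem_ofPred_eq] at h1 h2
        linarith
    rw [← measure_union hdis (measurableSet_lt measurable_const hb.neg.continuous.measurable)]
    exact measure_mono (Set.subset_univ _)
  rcases le_total (ν {x | 0 < b x}) (ν {x | 0 < -b x}) with h | h
  · refine hpos b hb hint hmean (le_trans ?_ hsum)
    rw [two_mul]
    gcongr
  · have := hpos (fun x => -b x) hb.neg hint.neg (by rw [integral_neg, hmean, neg_zero]) ?_
    · simpa [fderiv_fun_neg] using this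
    · refine le_trans ?_ hsum
      rw [two_mul]
      gcongr

end IsExpanding

theorem le_infDist_frontier {X : Type*} [PseudoMetricSpace X] {K : Set X}
    (hK : (frontier K).Nonempty) {x : X} {s : ℝ} (hs : ball x s ⊆ K) :
    s ≤ infDist x (frontier K) := by
  refine (le_infDist hK).2 fun y hy => ?_
  by_contra! h
  exact hy.2 (interior_maximal hs isOpen_ball (by rwa [mem_ball, dist_comm]))

section infDistFrontier

variable {E : Type*} [NormedAddCommGroup E] [NormedSpace ℝ E] {K : Set E}

theorem ball_infDist_frontier_subset {x : E} (hx : x ∈ K) :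
    ball x (infDist x (frontier K)) ⊆ K := by
  rcases (ball x (infDist x (frontier K))).eq_empty_or_nonempty with he | hne
  · simp [he]
  have hpos : 0 < infDist x (frontier K) := nonempty_ball.1 hne
  have hdis : ∀ y ∈ ball x (infDist x (frontier K)), y ∉ frontier K := fun y hy hyf =>
    notMem_of_dist_lt_infDist (by rwa [dist_comm]) hyf
  have hcov : ball x (infDist x (frontier K)) ⊆ interior K ∪ (closure K)ᶜ := fun y hy => by
    by_contra h
    rw [Set.mem_union, not_or, Set.mem_compl_iff, not_not] at h
    exact hdis y hy ⟨h.2, h.1⟩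
  have hxi : x ∈ interior K := by
    rcases hcov (mem_ball_self hpos) with h | h
    · exact h
    · exact absurd (subset_closure hx) h
  exact ((convex_ball x _).isPreconnected.subset_left_of_subset_union isOpen_interior
    isClosed_closure.isOpen_compl (disjoint_compl_right.mono_left
      (interior_subset.trans subset_closure)) hcov ⟨x, mem_ball_self hpos, hxi⟩).trans
    interior_subset

theorem Convex.concaveOn_infDist_frontier (hK : Convex ℝ K) (hfr : (frontier K).Nonempty) :
    ConcaveOn ℝ K fun x => infDist x (frontier K) := by
  refine ⟨hK, fun x hx y hy a b ha hb hab => ?_⟩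
  simp only [smul_eq_mul]
  set p := infDist x (frontier K) with hp
  set q := infDist y (frontier K) with hq
  have hp0 : 0 ≤ p := infDist_nonneg
  have hq0 : 0 ≤ q := infDist_nonneg
  refine le_infDist_frontier hfr fun z hz => ?_
  set w := z - (a • x + b • y) with hw
  set S := a * p + b * q with hS
  have hwS : ‖w‖ < S := by rwa [mem_ball, dist_eq_norm] at hz
  have hSpos : 0 < S := (norm_nonneg w).trans_lt hwS
  have hmem : ∀ u ∈ K, u + (infDist u (frontier K) / S) • w ∈ K := by
    intro u hu
    rcases (infDist_nonneg (x := u) (s := frontier K)).eq_or_lt with h0 | h0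
    · simpa [← h0] using hu
    · refine ball_infDist_frontier_subset hu ?_
      rw [mem_ball, dist_eq_norm, add_sub_cancel_left, norm_smul,
        Real.norm_of_nonneg (by positivity), div_mul_eq_mul_div, div_lt_iff₀ hSpos]
      gcongr
  have := hK (hmem x hx) (hmem y hy) ha hb hab
  convert this using 1
  have hcoef : a * (p / S) + b * (q / S) = 1 := by
    rw [← mul_div_assoc, ← mul_div_assoc, ← add_div, div_self hSpos.ne']
  calc z = a • x + b • y + (a * (p / S) + b * (q / S)) • w := by rw [hcoef, one_smul, hw]; abel
    _ = _ := by simp only [smul_add, add_smul, mul_smul, ← hp, ← hq]; abel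

/-- Interior points obtained by contracting a convex set towards an inscribed ball. -/
theorem Convex.mul_le_infDist_frontier (hK : Convex ℝ K) (hfr : (frontier K).Nonempty) {r c : ℝ}
    (hball : closedBall 0 r ⊆ K) (hc0 : 0 ≤ c) (hc1 : c ≤ 1) {x : E} (hx : x ∈ K) :
    c * r ≤ infDist ((1 - c) • x) (frontier K) := by
  refine le_infDist_frontier hfr fun z hz => ?_
  rw [mem_ball, dist_eq_norm] at hz
  rcases hc0.eq_or_lt with rfl | hc
  · exact absurd hz (by simp [norm_nonneg])
  have hu : c⁻¹ • (z - (1 - c) • x) ∈ K := by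
    refine hball (mem_closedBall_zero_iff.2 ?_)
    rw [norm_smul, norm_inv, Real.norm_of_nonneg hc0, inv_mul_le_iff₀ hc]
    exact hz.le
  have := hK hx hu (sub_nonneg.2 hc1) hc0 (by ring)
  rwa [smul_inv_smul₀ hc.ne', add_sub_cancel] at this

variable [MeasurableSpace E] [BorelSpace E] {μ : Measure E}

theorem Convex.isExpanding_withDensity_infDist (hμ : PrekopaLeindler μ) (hK : Convex ℝ K)
    (hKm : MeasurableSet K) (hfr : (frontier K).Nonempty) {D : ℝ} (hD : 0 < D)
    (hdiam : ∀ x ∈ K, ∀ y ∈ K, dist x y ≤ D) :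
    IsExpanding D ((μ.restrict K).withDensity fun x =>
      ENNReal.ofReal (infDist x (frontier K))) := by
  intro t ht0 ht1 A U hA hU hAU
  have ht1' : 0 < 1 - t := sub_pos.2 ht1
  have hρ : Measurable fun x => ENNReal.ofReal (infDist x (frontier K)) :=
    measurable_infDist.ennreal_ofReal
  have hmeas : ∀ S : Set E, MeasurableSet S → ((μ.restrict K).withDensity fun x =>
      ENNReal.ofReal (infDist x (frontier K))) S
      = ∫⁻ x, (S ∩ K).indicator (fun x => ENNReal.ofReal (infDist x (frontier K))) x ∂μ := by
    intro S hS
    rw [withDensity_apply _ hS, Measure.restrict_restrict hS, lintegral_indicator (hS.inter hKm)]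
  rw [hmeas A hA, hmeas U hU, hmeas _ MeasurableSet.univ]
  refine hμ t ht0 ht1 _ _ _ (hρ.indicator (hA.inter hKm))
    (hρ.indicator (MeasurableSet.univ.inter hKm)) (hρ.indicator (hU.inter hKm)) fun x y => ?_
  by_cases hx : x ∈ A ∩ K
  swap
  · simp [Set.indicator_of_notMem hx, ENNReal.zero_rpow_of_pos ht1']
  by_cases hy : y ∈ K
  swap
  · simp [hy, ENNReal.zero_rpow_of_pos ht0]
  have hz : (1 - t) • x + t • y ∈ U ∩ K := by
    refine ⟨?_, hK hx.2 hy ht1'.le ht0.le (by ring)⟩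
    have hv : ‖D⁻¹ • (y - x)‖ ≤ 1 := by
      rw [norm_smul, norm_inv, Real.norm_of_nonneg hD.le, inv_mul_le_iff₀ hD, mul_one,
        ← dist_eq_norm]
      exact hdiam y hy x hx.2
    convert hAU x hx.1 _ hv using 1
    rw [smul_smul, mul_right_comm, mul_inv_cancel₀ hD.ne', one_mul, smul_sub, sub_smul, one_smul]
    abel
  have hy' : y ∈ Set.univ ∩ K := ⟨Set.mem_univ y, hy⟩
  rw [Set.indicator_of_mem hx, Set.indicator_of_mem hy',
    Set.indicator_of_mem hz, ENNReal.ofReal_rpow_of_nonneg infDist_nonneg ht1'.le,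
    ENNReal.ofReal_rpow_of_nonneg infDist_nonneg ht0.le,
    ← ENNReal.ofReal_mul (Real.rpow_nonneg infDist_nonneg _)]
  refine ENNReal.ofReal_le_ofReal ((Real.geom_mean_le_arith_mean2_weighted ht1'.le ht0.le
    infDist_nonneg infDist_nonneg (by ring)).trans ?_)
  exact (hK.concaveOn_infDist_frontier hfr).2 hx.2 hy ht1'.le ht0.le (by ring)

theorem Convex.measureReal_infDist_frontier_lt_le [FiniteDimensional ℝ E] [μ.IsAddHaarMeasure]
    (hK : Convex ℝ K) (hKtop : μ K ≠ ⊤) (hfr : (frontier K).Nonempty)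
    {r s : ℝ} (hr : 0 < r) (hball : closedBall 0 r ⊆ K) (hs : 0 ≤ s) :
    μ.real (K ∩ {x | infDist x (frontier K) < s})
      ≤ Module.finrank ℝ E * (s / r) * μ.real K := by
  have hSm : MeasurableSet {x | infDist x (frontier K) < s} :=
    measurableSet_lt measurable_infDist measurable_const
  have hdim : Module.finrank ℝ E = 0 ∨ 1 ≤ Module.finrank ℝ E := by omega
  rcases hdim with h0 | h1
  · have : Subsingleton E := Module.finrank_zero_iff.1 h0
    exact absurd hfr (by
      have : K = Set.univ := Set.eq_univ_of_forall fun x =>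
        Subsingleton.elim 0 x ▸ hball (mem_closedBall_self hr.le)
      simp [this])
  set N := Module.finrank ℝ E
  rcases le_total (s / r) 1 with hsr | hsr
  · have hc : 0 ≤ 1 - s / r := sub_nonneg.2 hsr
    have hsub : (1 - s / r) • K ⊆ K \ {x | infDist x (frontier K) < s} := by
      rintro _ ⟨x, hx, rfl⟩
      have h0 : (0 : E) ∈ K := hball (mem_closedBall_self hr.le)
      refine ⟨hK.smul_mem_of_zero_mem h0 hx ⟨hc, by linarith [div_nonneg hs hr.le]⟩, ?_⟩
      have := hK.mul_le_infDist_frontier hfr hball (div_nonneg hs hr.le) hsr hx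
      rw [div_mul_cancel₀ _ hr.ne'] at this
      simpa using this
    have hmono := measureReal_mono (μ := μ) hsub
      (ne_top_of_le_ne_top hKtop (measure_mono Set.sdiff_subset))
    have hsmul : μ.real ((1 - s / r) • K) = (1 - s / r) ^ N * μ.real K := by
      rw [measureReal_def, Measure.addHaar_smul, ENNReal.toReal_mul,
        ENNReal.toReal_ofReal (abs_nonneg _), abs_of_nonneg (pow_nonneg hc _), measureReal_def]
    have hsplit := measureReal_inter_add_sdiff (μ := μ) (s := K) hSm hKtop
    have hbern := one_add_mul_le_pow (a := -(s / r)) (by linarith) N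
    rw [← sub_eq_add_neg] at hbern
    have hb2 := mul_le_mul_of_nonneg_right hbern (measureReal_nonneg (μ := μ) (s := K))
    rw [hsmul] at hmono
    linarith
  · have h2 : (1 : ℝ) ≤ N * (s / r) := by
      have : (1 : ℝ) ≤ N := by exact_mod_cast h1
      nlinarith
    calc _ ≤ μ.real K := measureReal_mono Set.inter_subset_left hKtop
      _ ≤ _ := le_mul_of_one_le_left measureReal_nonneg h2

end infDistFrontier

theorem integral_abs_le_of_weighted {E : Type*} [NormedAddCommGroup E] [NormedSpace ℝ E]
    [MeasurableSpace E] [BorelSpace E] [FiniteDimensional ℝ E] {μ : Measure E}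
    [μ.IsAddHaarMeasure] {K : Set E} (hK : Convex ℝ K) (hKc : IsCompact K)
    (hfr : (frontier K).Nonempty) {r : ℝ} (hr : 0 < r) (hball : closedBall 0 r ⊆ K)
    {b : E → ℝ} (hb : Continuous b) {S s : ℝ} (hs : 0 < s) (hS : ∀ x ∈ K, |b x| ≤ S) :
    ∫ x in K, |b x| ∂μ ≤ S * μ.real K * (Module.finrank ℝ E / r) * s
      + (∫ x in K, |b x| * infDist x (frontier K) ∂μ) / s := by
  have hKm : MeasurableSet K := hKc.measurableSet
  have hT : MeasurableSet {x | infDist x (frontier K) < s} :=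
    measurableSet_lt measurable_infDist measurable_const
  set T := {x | infDist x (frontier K) < s} with hTdef
  have hS0 : 0 ≤ S := (abs_nonneg _).trans (hS 0 (hball (mem_closedBall_self hr.le)))
  have hi1 : IntegrableOn (fun x => |b x|) K μ := hb.abs.continuousOn.integrableOn_compact hKc
  have hi2 : IntegrableOn (fun x => |b x| * infDist x (frontier K)) K μ :=
    (hb.abs.mul (continuous_infDist_pt _)).continuousOn.integrableOn_compact hKc
  have hi3 : IntegrableOn (T.indicator fun _ => S) K μ :=
    (integrableOn_const hKc.measure_lt_top.ne).indicator hT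
  have hmono : ∫ x in K, |b x| ∂μ
      ≤ ∫ x in K, (T.indicator (fun _ => S) x + |b x| * infDist x (frontier K) / s) ∂μ := by
    refine setIntegral_mono_on hi1 (hi3.add (hi2.div_const s)) hKm fun x hx => ?_
    by_cases hxT : x ∈ T
    · rw [Set.indicator_of_mem hxT]
      have : 0 ≤ |b x| * infDist x (frontier K) / s :=
        div_nonneg (mul_nonneg (abs_nonneg _) infDist_nonneg) hs.le
      linarith [hS x hx]
    · rw [Set.indicator_of_notMem hxT, zero_add, le_div_iff₀ hs]
      gcongr
      exact not_lt.1 hxT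
  refine hmono.trans ?_
  rw [integral_add hi3 (hi2.div_const s), integral_div]
  gcongr
  rw [setIntegral_indicator hT, setIntegral_const, smul_eq_mul]
  have h := hK.measureReal_infDist_frontier_lt_le (μ := μ) hKc.measure_lt_top.ne hfr hr hball hs.le
  calc _ ≤ Module.finrank ℝ E * (s / r) * μ.real K * S := by gcongr
    _ = _ := by ring

theorem sq_le_four_mul_of_forall_le {J a c : ℝ} (hJ : 0 ≤ J) (ha : 0 < a) (hc : 0 ≤ c)
    (h : ∀ s > 0, J ≤ a * s + c / s) : J ^ 2 ≤ 4 * (a * c) := by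
  rcases hJ.eq_or_lt with rfl | hJ
  · rw [zero_pow two_ne_zero]
    positivity
  have h1 := h (J / (2 * a)) (by positivity)
  have h2 : a * (J / (2 * a)) = J / 2 := by field_simp
  have h3 : c / (J / (2 * a)) = 2 * (a * c) / J := by field_simp
  rw [h2, h3] at h1
  have h4 : J / 2 ≤ 2 * (a * c) / J := by linarith
  rw [le_div_iff₀ hJ] at h4
  nlinarith

theorem le_rpow_mul_rpow_of_sq_le {J X Y A lam : ℝ} (hJ : 0 ≤ J) (hY : 0 ≤ Y) (hA : 1 ≤ A)
    (hlam : 2 < lam) (hJX : J ≤ X) (hsq : J ^ 2 ≤ A * (X * Y)) :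
    J ≤ A * (X / ((lam - 2) / (lam - 1))) ^ (1 - 1 / lam) * Y ^ (1 / lam) := by
  have hlam0 : 0 < lam := by linarith
  have hX : 0 ≤ X := hJ.trans hJX
  have hβ0 : 0 < (lam - 2) / (lam - 1) := div_pos (by linarith) (by linarith)
  have hβ1 : (lam - 2) / (lam - 1) ≤ 1 := (div_le_one (by linarith)).2 (by linarith)
  have hA0 : 0 ≤ A := by linarith
  have he : 1 / lam ≤ 1 / 2 := one_div_le_one_div_of_le two_pos hlam.le
  rcases hJ.eq_or_lt with rfl | hJ
  · positivity
  have hX0 : 0 < X := hJ.trans_le hJX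
  calc J = J ^ (1 - 2 / lam) * (J ^ 2) ^ (1 / lam) := by
        rw [← Real.rpow_natCast, ← Real.rpow_mul hJ.le, ← Real.rpow_add hJ]
        conv_lhs => rw [← Real.rpow_one J]
        congr 1
        push_cast
        ring
    _ ≤ X ^ (1 - 2 / lam) * (A * (X * Y)) ^ (1 / lam) := by
        have : 0 ≤ 1 - 2 / lam := by
          rw [show 2 / lam = 2 * (1 / lam) by ring]
          linarith
        gcongr
    _ = A ^ (1 / lam) * X ^ (1 - 1 / lam) * Y ^ (1 / lam) := by
        rw [Real.mul_rpow hA0 (by positivity), Real.mul_rpow hX hY,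
          show 1 - 1 / lam = (1 - 2 / lam) + 1 / lam by ring, Real.rpow_add hX0]
        ring
    _ ≤ _ := by
        have h1 : A ^ (1 / lam) ≤ A := by
          conv_rhs => rw [← Real.rpow_one A]
          exact Real.rpow_le_rpow_of_exponent_le hA (by linarith)
        have h2 : X ≤ X / ((lam - 2) / (lam - 1)) := le_div_self hX hβ0 hβ1
        have h3 : 0 ≤ 1 - 1 / lam := by linarith
        gcongr

/-- Weighted `L¹` Poincaré inequality on a convex body, with the distance to the boundary as
weight. -/
theorem Convex.log_two_mul_setIntegral_abs_mul_infDist_le {E : Type*} [NormedAddCommGroup E]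
    [NormedSpace ℝ E] [MeasurableSpace E] [BorelSpace E] [FiniteDimensional ℝ E] {μ : Measure E}
    [μ.IsAddHaarMeasure] (hμ : PrekopaLeindler μ) {K : Set E} (hK : Convex ℝ K)
    (hKc : IsCompact K) (hfr : (frontier K).Nonempty) {D : ℝ} (hD : 0 < D)
    (hdiam : ∀ x ∈ K, ∀ y ∈ K, dist x y ≤ D) {b : E → ℝ} {M : NNReal} (hb : LipschitzWith M b)
    (hmean : ∫ x in K, b x * infDist x (frontier K) ∂μ = 0) :
    Real.log 2 * ∫ x in K, |b x| * infDist x (frontier K) ∂μ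
      ≤ 2 * D * ∫ x in K, ‖fderiv ℝ b x‖ * infDist x (frontier K) ∂μ := by
  have hρ : Measurable fun x => ENNReal.ofReal (infDist x (frontier K)) :=
    measurable_infDist.ennreal_ofReal
  set ν := (μ.restrict K).withDensity fun x => ENNReal.ofReal (infDist x (frontier K)) with hν
  have hexp : IsExpanding D ν :=
    hK.isExpanding_withDensity_infDist hμ hKc.measurableSet hfr hD hdiam
  have hac : ν ≪ μ := (withDensity_absolutelyContinuous _ _).trans
    Measure.restrict_le_self.absolutelyContinuous
  have hint : ∀ f : E → ℝ, ∫ x, f x ∂ν = ∫ x in K, f x * infDist x (frontier K) ∂μ := by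
    intro f
    rw [hν, integral_withDensity_eq_integral_toReal_smul hρ
      (Filter.Eventually.of_forall fun x => ENNReal.ofReal_lt_top)]
    refine integral_congr_ae (Filter.Eventually.of_forall fun x => ?_)
    simp only [ENNReal.toReal_ofReal infDist_nonneg, smul_eq_mul, mul_comm]
  have hρi : IntegrableOn (fun x => infDist x (frontier K)) K μ :=
    (continuous_infDist_pt _).continuousOn.integrableOn_compact hKc
  have : IsFiniteMeasure ν := isFiniteMeasure_withDensity_ofReal hρi.2
  have hbi : Integrable b ν := by
    rw [hν, integrable_withDensity_iff_integrable_smul' hρ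
      (Filter.Eventually.of_forall fun x => ENNReal.ofReal_lt_top)]
    refine ((hb.continuous.mul (continuous_infDist_pt (frontier K))).continuousOn.integrableOn_compact
      hKc).congr (Filter.Eventually.of_forall fun x => ?_)
    simp only [ENNReal.toReal_ofReal infDist_nonneg, smul_eq_mul, mul_comm, Pi.mul_apply]
  have h := hexp.log_two_mul_integral_abs_le hac hD hb hbi (by rw [hint, hmean])
  rwa [hint, hint] at h

theorem norm_gradient {F : Type*} [NormedAddCommGroup F] [InnerProductSpace ℝ F] [CompleteSpace F]
    (b : F → ℝ) (x : F) : ‖gradient b x‖ = ‖fderiv ℝ b x‖ :=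
  LinearIsometryEquiv.norm_map _ _

/-- Weighted Poincaré type inequality for convex domains (Theorem `Thm-OurPoincare`):
if `b` has mean zero with respect to the weight `ρ(x) = dist(x, ∂K)`, then for every
`λ ∈ (2, ∞)`, with `β = (λ-2)/(λ-1)`,
`∫_K |b| ≤ C (‖b‖_∞ |K| / β)^(1-1/λ) (n (R/r) ∫_K |∇b| ρ)^(1/λ)`. -/
theorem weighted_poincare_convex :
    ∃ C : ℝ, 0 < C ∧ ∀ (n : ℕ), 2 ≤ n →
      ∀ (K : Set (EuclideanSpace ℝ (Fin n))) (r R : ℝ),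
        IsCompact K → Convex ℝ K → 0 < r → r ≤ R →
        r • closedBall (0 : EuclideanSpace ℝ (Fin n)) 1 ⊆ K →
        K ⊆ R • closedBall (0 : EuclideanSpace ℝ (Fin n)) 1 →
        ∀ b : EuclideanSpace ℝ (Fin n) → ℝ,
          (∃ M : NNReal, LipschitzOnWith M b K) →
          BddAbove ((fun x => |b x|) '' K) →
          (∫ x in K, b x * infDist x (frontier K)) = 0 →
          ∀ lam : ℝ, lam ∈ Set.Ioi (2 : ℝ) →
            (∫ x in K, |b x|) ≤
              C * ((⨆ x ∈ K, |b x|) * (volume K).toReal / ((lam - 2) / (lam - 1)))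
                    ^ (1 - 1 / lam) *
                ((n : ℝ) * (R / r) *
                    ∫ x in K, ‖gradient b x‖ * infDist x (frontier K)) ^ (1 / lam) := by
  refine ⟨32, by norm_num, ?_⟩
  intro n hn K r R hKc hK hr hrR hrK hKR b ⟨M, hbM⟩ hbdd hmean lam hlam
  have hR : 0 < R := hr.trans_le hrR
  have hball : closedBall (0 : EuclideanSpace ℝ (Fin n)) r ⊆ K := by
    simpa [smul_unitClosedBall_of_nonneg hr.le] using hrK
  have hKR' : K ⊆ closedBall (0 : EuclideanSpace ℝ (Fin n)) R := by
    simpa [smul_unitClosedBall_of_nonneg hR.le] using hKR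
  have h0K : (0 : EuclideanSpace ℝ (Fin n)) ∈ K := hball (mem_closedBall_self hr.le)
  have : Nonempty (Fin n) := ⟨⟨0, by omega⟩⟩
  have : NoncompactSpace (EuclideanSpace ℝ (Fin n)) := NormedSpace.noncompactSpace ℝ _
  have hfr : (frontier K).Nonempty := nonempty_frontier_iff.2 ⟨⟨0, h0K⟩, hKc.ne_univ⟩
  have hdiam : ∀ x ∈ K, ∀ y ∈ K, dist x y ≤ 2 * R := fun x hx y hy => by
    have h1 := mem_closedBall.1 (hKR' hx)
    have h2 := mem_closedBall'.1 (hKR' hy)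
    linarith [dist_triangle x 0 y]
  obtain ⟨g, hg, hbg⟩ := hbM.extend_real
  have hKm := hKc.measurableSet
  have hgrad : ∫ x in K, ‖gradient b x‖ * infDist x (frontier K)
      = ∫ x in K, ‖fderiv ℝ g x‖ * infDist x (frontier K) := by
    refine setIntegral_congr_fun hKm fun x hx => ?_
    by_cases hxi : x ∈ interior K
    · have hev : b =ᶠ[nhds x] g := hbg.eventuallyEq_of_mem (mem_interior_iff_mem_nhds.1 hxi)
      simp only [norm_gradient, hev.fderiv_eq]
    · have : x ∈ frontier K := ⟨subset_closure hx, hxi⟩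
      simp only [infDist_zero_of_mem this, mul_zero]
  have habs : ∫ x in K, |b x| = ∫ x in K, |g x| :=
    setIntegral_congr_fun hKm fun x hx => by simp only [hbg hx]
  have hmean' : ∫ x in K, g x * infDist x (frontier K) = 0 := by
    rw [← hmean]
    exact setIntegral_congr_fun hKm fun x hx => by simp only [hbg hx]
  set S := ⨆ x ∈ K, |b x| with hSdef
  have hS : ∀ x ∈ K, |g x| ≤ S := by
    obtain ⟨B, hB⟩ := hbdd
    have hB0 : 0 ≤ B := (abs_nonneg _).trans (hB ⟨0, h0K, rfl⟩)
    intro x hx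
    rw [← hbg hx]
    refine le_ciSup_of_le ⟨B, ?_⟩ x (by simp [hx])
    rintro _ ⟨y, rfl⟩
    exact Real.iSup_le (fun hy => hB ⟨y, hy, rfl⟩) hB0
  have hpoinc := hK.log_two_mul_setIntegral_abs_mul_infDist_le (prekopaLeindler_euclideanSpace n)
    hKc hfr (by positivity) hdiam hg hmean'
  have hvol : 0 < volume.real K := by
    refine ENNReal.toReal_pos (ne_of_gt ?_) hKc.measure_lt_top.ne
    exact (measure_closedBall_pos volume _ hr).trans_le (measure_mono hball)
  have hS0 : 0 ≤ S := (abs_nonneg _).trans (hS 0 h0K)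
  have hn0 : (0 : ℝ) < n := by exact_mod_cast (by omega : 0 < n)
  rw [habs, hgrad]
  set J := ∫ x in K, |g x| with hJ
  set I := ∫ x in K, |g x| * infDist x (frontier K) with hI
  set G := ∫ x in K, ‖fderiv ℝ g x‖ * infDist x (frontier K) with hG
  have hJ0 : 0 ≤ J := integral_nonneg fun x => abs_nonneg _
  have hG0 : 0 ≤ G := integral_nonneg fun x => mul_nonneg (norm_nonneg _) infDist_nonneg
  have hI0 : 0 ≤ I := integral_nonneg fun x => mul_nonneg (abs_nonneg _) infDist_nonneg
  have hJX : J ≤ S * volume.real K := by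
    have := setIntegral_mono_on (hg.continuous.abs.continuousOn.integrableOn_compact hKc)
      (integrableOn_const hKc.measure_lt_top.ne) hKm hS (μ := volume)
    rwa [setIntegral_const, smul_eq_mul, mul_comm] at this
  refine le_rpow_mul_rpow_of_sq_le hJ0 (by positivity) (by norm_num) hlam hJX ?_
  rcases hS0.eq_or_lt with hS0 | hS0
  · have : J = 0 := le_antisymm (by simpa [← hS0] using hJX) hJ0
    rw [this]
    simp [← hS0]
  have hsq : J ^ 2 ≤ 4 * (S * volume.real K * (n / r) * I) :=
    sq_le_four_mul_of_forall_le hJ0 (by positivity) hI0 fun s hs => by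
      simpa using integral_abs_le_of_weighted (μ := volume) hK hKc hfr hr hball hg.continuous hs hS
  have hlog : (1 / 2 : ℝ) ≤ Real.log 2 := by linarith [Real.log_two_gt_d9]
  have hI8 : I ≤ 8 * R * G := by nlinarith
  calc J ^ 2 ≤ 4 * (S * volume.real K * (n / r) * I) := hsq
    _ ≤ 4 * (S * volume.real K * (n / r) * (8 * R * G)) := by gcongr
    _ = 32 * (S * volume.real K * (n * (R / r) * G)) := by ring
end

section
/- Let n ≥ 1 and let K ⊂ ℝⁿ be a compact convex set with r·D_n ⊆ K ⊆ R·D_n for some 0 < r ≤ R. Then n/R ≤ |∂K|/|K| ≤ n/r, where |∂K| is the surface area of K. -/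
open MeasureTheory Pointwise Metric Filter

/-- The right difference quotient at `0` of the volume of the dilates `(1 + c * t) • K` of a
convex set, written as the Minkowski sums `K + (c * t) • K`, converges to `n * c * |K|`. -/
theorem tendsto_volume_add_smul_sub_div {n : ℕ} {K : Set (EuclideanSpace ℝ (Fin n))}
    (hconv : Convex ℝ K) {c : ℝ} (hc : 0 ≤ c) :
    Tendsto (fun t : ℝ =>
        ((volume (K + (c * t) • K)).toReal - (volume K).toReal) / t)
      (nhdsWithin 0 (Set.Ioi 0)) (nhds (n * c * (volume K).toReal)) := by
  have hd : HasDerivAt (fun t : ℝ => (1 + c * t) ^ n * (volume K).toReal)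
      (n * c * (volume K).toReal) 0 := by
    have h := ((((hasDerivAt_id (0 : ℝ)).const_mul c).const_add 1).pow n).mul_const
      (volume K).toReal
    simpa using h
  have hslope := (hasDerivAt_iff_tendsto_slope_zero.1 hd).mono_left
    (nhdsWithin_mono 0 fun t (ht : 0 < t) => ht.ne')
  refine hslope.congr' ?_
  filter_upwards [self_mem_nhdsWithin] with t (ht : 0 < t)
  have hct : 0 ≤ c * t := by positivity
  have hK : K + (c * t) • K = (1 + c * t) • K := by
    rw [hconv.add_smul zero_le_one hct, one_smul]
  rw [hK, Measure.addHaar_smul, finrank_euclideanSpace_fin, ENNReal.toReal_mul,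
    ENNReal.toReal_ofReal (abs_nonneg _), abs_of_nonneg (by positivity), div_eq_inv_mul]
  simp

/-- For a compact convex set `K` with `r·D_n ⊆ K ⊆ R·D_n`, the surface area `S`
(outer Minkowski content) satisfies `n/R ≤ S/|K| ≤ n/r`. -/
theorem surface_area_volume_ratio {n : ℕ} (hn : 1 ≤ n)
    (K : Set (EuclideanSpace ℝ (Fin n))) (hK : IsCompact K) (hconv : Convex ℝ K)
    (r R : ℝ) (hr : 0 < r) (hrR : r ≤ R)
    (h₁ : r • closedBall (0 : EuclideanSpace ℝ (Fin n)) 1 ⊆ K)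
    (h₂ : K ⊆ R • closedBall (0 : EuclideanSpace ℝ (Fin n)) 1)
    (S : ℝ)
    (hS : Tendsto (fun t : ℝ =>
        ((volume (K + t • closedBall (0 : EuclideanSpace ℝ (Fin n)) 1)).toReal -
          (volume K).toReal) / t)
      (nhdsWithin 0 (Set.Ioi 0)) (nhds S)) :
    (n : ℝ) / R ≤ S / (volume K).toReal ∧ S / (volume K).toReal ≤ (n : ℝ) / r := by
  have hR : 0 < R := hr.trans_le hrR
  have hV : 0 < (volume K).toReal := by
    refine ENNReal.toReal_pos (ne_of_gt ?_) hK.measure_lt_top.ne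
    refine lt_of_lt_of_le ?_ (measure_mono h₁)
    rw [smul_unitClosedBall_of_nonneg hr.le]
    exact measure_closedBall_pos volume _ hr
  constructor
  · rw [le_div_iff₀ hV, div_eq_mul_inv]
    refine le_of_tendsto_of_tendsto
      (tendsto_volume_add_smul_sub_div hconv (inv_nonneg.2 hR.le)) hS ?_
    filter_upwards [self_mem_nhdsWithin] with t (ht : 0 < t)
    have hsub : (R⁻¹ * t) • K ⊆ t • closedBall (0 : EuclideanSpace ℝ (Fin n)) 1 := by
      refine (Set.smul_set_mono h₂).trans_eq ?_
      rw [smul_smul, mul_right_comm, inv_mul_cancel₀ hR.ne', one_mul]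
    gcongr
    exact (hK.add ((isCompact_closedBall _ _).smul t)).measure_lt_top.ne
  · rw [div_le_iff₀ hV, div_eq_mul_inv]
    refine le_of_tendsto_of_tendsto hS
      (tendsto_volume_add_smul_sub_div hconv (inv_nonneg.2 hr.le)) ?_
    filter_upwards [self_mem_nhdsWithin] with t (ht : 0 < t)
    have hsub : t • closedBall (0 : EuclideanSpace ℝ (Fin n)) 1 ⊆ (r⁻¹ * t) • K := by
      refine Eq.trans_subset ?_ (Set.smul_set_mono h₁)
      rw [smul_smul, mul_right_comm, inv_mul_cancel₀ hr.ne', one_mul]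
    gcongr
    exact (hK.add (hK.smul (r⁻¹ * t))).measure_lt_top.ne
end

section
/- Let n ≥ 1, let K ⊂ ℝⁿ be a compact convex set with r·D_n ⊆ K for some r > 0, and let β ∈ (0,1). Then ∫_K ρ(x)^{β−1} dx < C·n^{1−β}·|K|/(β·r^{1−β}), where ρ(x) = dist(x, ∂K) and C > 0 is a universal constant. -/
open MeasureTheory Pointwise Metric

/-- If a convex set contains the ball of radius `r` about the origin, it contains the ball of
radius `u * r` about every point of its homothetic copy of ratio `1 - u`. -/
lemma Convex.ball_subset_of_mem_smul {E : Type*} [NormedAddCommGroup E] [NormedSpace ℝ E]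
    {K : Set E} {r u : ℝ} (hK : Convex ℝ K) (hr : ball (0 : E) r ⊆ K) (hu : 0 < u) (hu1 : u ≤ 1)
    {x : E} (hx : x ∈ (1 - u) • K) : ball x (u * r) ⊆ K := by
  obtain ⟨y, hy, rfl⟩ := hx
  intro z hz
  have hw : u⁻¹ • (z - (1 - u) • y) ∈ K := by
    apply hr
    rw [mem_ball_zero_iff, norm_smul, norm_inv, Real.norm_of_nonneg hu.le, inv_mul_lt_iff₀ hu]
    simpa [dist_eq_norm] using hz
  have h := hK hy hw (sub_nonneg.2 hu1) hu.le (by ring)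
  rwa [smul_inv_smul₀ hu.ne', add_sub_cancel] at h

lemma IsCompact.frontier_nonempty {E : Type*} [TopologicalSpace E] [PreconnectedSpace E]
    [NoncompactSpace E] {K : Set E} (hK : IsCompact K) (hne : K.Nonempty) :
    (frontier K).Nonempty := by
  rw [nonempty_frontier_iff]
  exact ⟨hne, hK.ne_univ⟩

/-- In a convex body containing the ball of radius `r` about the origin, the points of the copy of
ratio `1 - u` are at distance at least `u * r` from the boundary. -/
lemma Convex.le_infDist_frontier {E : Type*} [NormedAddCommGroup E] [NormedSpace ℝ E]
    {K : Set E} {r u : ℝ} (hK : Convex ℝ K) (hr : ball (0 : E) r ⊆ K) (hu : 0 < u) (hu1 : u ≤ 1)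
    (hne : (frontier K).Nonempty) {x : E} (hx : x ∈ (1 - u) • K) :
    u * r ≤ infDist x (frontier K) := by
  rw [le_infDist hne]
  intro y hy
  by_contra! h
  have : y ∈ interior K :=
    interior_maximal (hK.ball_subset_of_mem_smul hr hu hu1 hx) isOpen_ball (mem_ball'.2 h)
  exact hy.2 this

/-- The part of a convex body within distance `s` of the boundary has relative volume at most
`n * s / r`, where `r` is the radius of a ball about the origin contained in the body. -/
lemma Convex.volume_infDist_frontier_lt_le {E : Type*} [NormedAddCommGroup E] [NormedSpace ℝ E]
    [FiniteDimensional ℝ E] [MeasurableSpace E] [BorelSpace E] (μ : Measure E)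
    [μ.IsAddHaarMeasure] {K : Set E} {r s : ℝ} (hK : Convex ℝ K) (hc : IsCompact K)
    (hr0 : 0 < r) (hr : ball (0 : E) r ⊆ K) (hne : (frontier K).Nonempty) (hs : 0 < s) :
    μ ({x | infDist x (frontier K) < s} ∩ K) ≤
      ENNReal.ofReal (Module.finrank ℝ E * (s / r)) * μ K := by
  set n := Module.finrank ℝ E
  set u := s / r
  have hu : 0 < u := div_pos hs hr0
  rcases le_total 1 u with h1 | h1
  · rcases Nat.eq_zero_or_pos n with hn | hn
    · have : Subsingleton E := Module.finrank_zero_iff.1 hn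
      exfalso
      obtain ⟨y, hy⟩ := hne
      have : K = Set.univ := Set.eq_univ_of_forall fun z => hr (by simp [Subsingleton.elim z 0, hr0])
      simp [this] at hy
    · refine (measure_mono Set.inter_subset_right).trans (le_mul_of_one_le_left zero_le ?_)
      rw [ENNReal.one_le_ofReal]
      have : (1 : ℝ) ≤ n := by exact_mod_cast hn
      nlinarith
  · have h0 : (0 : E) ∈ K := hr (mem_ball_self hr0)
    have hsub : (1 - u) • K ⊆ K := by
      rintro _ ⟨y, hy, rfl⟩
      exact hK.smul_mem_of_zero_mem h0 hy ⟨by linarith, by linarith⟩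
    have hincl : {x | infDist x (frontier K) < s} ∩ K ⊆ K \ ((1 - u) • K) := by
      rintro x ⟨hx, hxK⟩
      refine ⟨hxK, fun hxu => ?_⟩
      have := hK.le_infDist_frontier hr hu h1 hne hxu
      rw [div_mul_cancel₀ _ hr0.ne'] at this
      exact absurd hx (not_lt.2 this)
    refine (measure_mono hincl).trans ?_
    have hc' : IsCompact ((1 - u) • K) := hc.smul _
    rw [measure_sdiff hsub hc'.measurableSet.nullMeasurableSet hc'.measure_lt_top.ne,
      Measure.addHaar_smul_of_nonneg μ (by linarith), tsub_le_iff_right, ← add_mul,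
      ← ENNReal.ofReal_add (by positivity) (pow_nonneg (by linarith) _)]
    refine le_mul_of_one_le_left zero_le ?_
    rw [ENNReal.one_le_ofReal]
    have := one_add_mul_le_pow (a := -u) (by linarith) n
    rw [← sub_eq_add_neg] at this
    linarith

/-- A measure with `μ {ρ < s} ≤ min (1, a * s) * M` for all `s` satisfies
`∫ ρ ^ (β - 1) ≤ a ^ (1 - β) * M / β`. -/
lemma lintegral_rpow_sub_one_le {α : Type*} [MeasurableSpace α] {μ : Measure α} {ρ : α → ℝ}
    {a β : ℝ} {M : ENNReal} (hρ : Measurable ρ) (hρ0 : ∀ x, 0 ≤ ρ x) (ha : 0 < a) (hβ : 0 < β)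
    (hβ1 : β < 1) (huniv : μ Set.univ ≤ M)
    (hμ : ∀ s, 0 < s → μ {x | ρ x < s} ≤ ENNReal.ofReal (a * s) * M) :
    ∫⁻ x, ENNReal.ofReal (ρ x ^ (β - 1)) ∂μ ≤ ENNReal.ofReal (a ^ (1 - β) / β) * M := by
  have hq : 0 < 1 - β := by linarith
  set p := 1 / (1 - β) with hp
  have hp1 : 1 < p := by rw [hp, lt_div_iff₀ hq]; linarith
  set T := a ^ (1 - β)
  have hT : 0 < T := Real.rpow_pos_of_pos ha _
  have hlevel : ∀ t, 0 < t → {x | t < ρ x ^ (β - 1)} ⊆ {x | ρ x < t ^ (-p)} := by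
    intro t ht x hx
    simp only [Set.mem_ofPred_eq] at hx ⊢
    have hpos : 0 < ρ x := by
      rcases (hρ0 x).eq_or_lt with h | h
      · rw [← h, Real.zero_rpow (by linarith)] at hx
        linarith
      · exact h
    have h := Real.rpow_lt_rpow_of_neg ht hx (show -p < 0 by linarith)
    rwa [← Real.rpow_mul hpos.le, show (β - 1) * -p = 1 by rw [hp]; field_simp; ring,
      Real.rpow_one] at h
  have hint : IntegrableOn (fun t : ℝ => a * t ^ (-p)) (Set.Ioi T) :=
    (integrableOn_Ioi_rpow_of_lt (by linarith) hT).const_mul a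
  have htail : ∫ t in Set.Ioi T, a * t ^ (-p) = T * ((1 - β) / β) := by
    rw [integral_const_mul, integral_Ioi_rpow_of_lt (by linarith) hT, ← Real.rpow_mul ha.le,
      show (1 - β) * (-p + 1) = -β by rw [hp]; field_simp; ring,
      show -p + 1 = -(β / (1 - β)) by rw [hp]; field_simp; ring,
      show T = a * a ^ (-β) by rw [← Real.rpow_one_add' ha.le (by linarith)]; rfl]
    field_simp
  calc ∫⁻ x, ENNReal.ofReal (ρ x ^ (β - 1)) ∂μ
      = ∫⁻ t in Set.Ioi 0, μ {x | t < ρ x ^ (β - 1)} :=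
        lintegral_eq_lintegral_meas_lt μ
          (Filter.Eventually.of_forall fun x => Real.rpow_nonneg (hρ0 x) _)
          (hρ.pow_const _).aemeasurable
    _ = (∫⁻ t in Set.Ioc 0 T, μ {x | t < ρ x ^ (β - 1)}) +
          ∫⁻ t in Set.Ioi T, μ {x | t < ρ x ^ (β - 1)} := by
        rw [← Set.Ioc_union_Ioi_eq_Ioi hT.le,
          lintegral_union measurableSet_Ioi (Set.Ioc_disjoint_Ioi le_rfl)]
    _ ≤ (∫⁻ t in Set.Ioc 0 T, M) + ∫⁻ t in Set.Ioi T, ENNReal.ofReal (a * t ^ (-p)) * M := by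
        refine add_le_add (lintegral_mono fun t => (measure_mono (Set.subset_univ _)).trans huniv)
          (setLIntegral_mono' measurableSet_Ioi fun t ht => ?_)
        have ht0 : 0 < t := hT.trans ht
        exact (measure_mono (hlevel t ht0)).trans (hμ _ (Real.rpow_pos_of_pos ht0 _))
    _ = ENNReal.ofReal T * M + ENNReal.ofReal (T * ((1 - β) / β)) * M := by
        rw [lintegral_const, Measure.restrict_apply_univ, Real.volume_Ioc, sub_zero, mul_comm M,
          lintegral_mul_const _ (by fun_prop), ← htail, ofReal_integral_eq_lintegral_ofReal hint]
        refine ae_restrict_of_forall_mem measurableSet_Ioi fun t ht => ?_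
        exact mul_nonneg ha.le (Real.rpow_nonneg (hT.trans ht).le _)
    _ = ENNReal.ofReal (T / β) * M := by
        rw [← add_mul, ← ENNReal.ofReal_add hT.le (by positivity)]
        congr 2
        field_simp
        ring

/-- For a compact convex set `K ⊆ ℝⁿ` with inner radius at least `r`, and `β ∈ (0,1)`,
`∫_K dist(x, ∂K)^(β-1) dx < C n^(1-β) |K| / (β r^(1-β))` for a universal constant `C`. -/
theorem integral_dist_boundary_rpow_lt :
    ∃ C : ℝ, 0 < C ∧ ∀ (n : ℕ), 1 ≤ n →
      ∀ (K : Set (EuclideanSpace ℝ (Fin n))) (r : ℝ),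
        IsCompact K → Convex ℝ K → 0 < r →
        r • closedBall (0 : EuclideanSpace ℝ (Fin n)) 1 ⊆ K →
        ∀ β : ℝ, β ∈ Set.Ioo (0 : ℝ) 1 →
          (∫ x in K, infDist x (frontier K) ^ (β - 1)) <
            C * (n : ℝ) ^ (1 - β) * (volume K).toReal / (β * r ^ (1 - β)) := by
  refine ⟨2, two_pos, fun n hn K r hc hK hr0 hrK β hβ => ?_⟩
  have hball : ball (0 : EuclideanSpace ℝ (Fin n)) r ⊆ K := by
    rw [smul_unitClosedBall_of_nonneg hr0.le] at hrK
    exact ball_subset_closedBall.trans hrK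
  have : Nonempty (Fin n) := ⟨⟨0, hn⟩⟩
  have : NoncompactSpace (EuclideanSpace ℝ (Fin n)) := NormedSpace.noncompactSpace ℝ _
  have hne := hc.frontier_nonempty ⟨0, hball (mem_ball_self hr0)⟩
  have hn0 : (0 : ℝ) < n := by exact_mod_cast hn
  have hfin : volume K ≠ ⊤ := hc.measure_lt_top.ne
  have hpos : 0 < (volume K).toReal :=
    ENNReal.toReal_pos ((measure_ball_pos volume _ hr0).trans_le (measure_mono hball)).ne' hfin
  have hmeas : Measurable fun x => infDist x (frontier K) := measurable_infDist
  have hle := lintegral_rpow_sub_one_le (μ := volume.restrict K) (M := volume K) (a := n / r)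
    hmeas (fun _ => infDist_nonneg) (by positivity) hβ.1 hβ.2 (by simp) fun s hs => by
      rw [Measure.restrict_apply (measurableSet_lt hmeas measurable_const)]
      convert hK.volume_infDist_frontier_lt_le volume hc hr0 hball hne hs using 3
      rw [finrank_euclideanSpace_fin]
      ring
  rw [integral_eq_lintegral_of_nonneg_ae
    (Filter.Eventually.of_forall fun x => Real.rpow_nonneg infDist_nonneg _)
    (hmeas.pow_const _).aestronglyMeasurable]
  have hT : 0 < (n / r : ℝ) ^ (1 - β) / β := div_pos (by positivity) hβ.1
  have h := ENNReal.toReal_mono (ENNReal.mul_ne_top ENNReal.ofReal_ne_top hfin) hle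
  rw [ENNReal.toReal_mul, ENNReal.toReal_ofReal hT.le] at h
  refine h.trans_lt ?_
  have heq : 2 * (n : ℝ) ^ (1 - β) * (volume K).toReal / (β * r ^ (1 - β)) =
      2 * ((n / r : ℝ) ^ (1 - β) / β * (volume K).toReal) := by
    rw [Real.div_rpow hn0.le hr0.le]
    field_simp
  rw [heq]
  linarith [mul_pos hT hpos]
end
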